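/- Let F and F̃ be ℍ-hulls with F ⊂ F̃, Im F̃ < ∞, and hcap(F̃) < ∞. Then the limit defining hcap(F) exists, and hcap(F) ≤ hcap(F̃). Moreover, if F ⊊ F̃ then hcap(F) < hcap(F̃) (strict monotonicity). -/

import Mathlib

open MeasureTheory Filter

/-- The complex upper half-plane. -/
def UH : Set ℂ := {z | 0 < z.im}

/-- A planar Brownian motion with sample space `Ω`: a family of probability
measures `P w` (the law of Brownian motion started at `w`), with continuous
paths, Gaussian increments and independent increments. -/
structure PlanarBM (Ω : Type*) [MeasurableSpace Ω] where
  Z : ℝ → Ω → ℂ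
  P : ℂ → Measure Ω
  isProb : ∀ w, IsProbabilityMeasure (P w)
  meas : ∀ t, Measurable (Z t)
  start : ∀ w, ∀ᵐ ω ∂P w, Z 0 ω = w
  contPaths : ∀ w, ∀ᵐ ω ∂P w, Continuous fun t => Z t ω
  incrLaw : ∀ (w : ℂ) (s t : ℝ), 0 ≤ s → s ≤ t →
    (P w).map (fun ω => Z t ω - Z s ω) =
      (((ProbabilityTheory.gaussianReal 0 (Real.toNNReal (t - s))).prod
        (ProbabilityTheory.gaussianReal 0 (Real.toNNReal (t - s)))).map
        fun p : ℝ × ℝ => Complex.equivRealProd.symm p)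
  indepIncr : ∀ (w : ℂ) (s t : ℝ), 0 ≤ s → s ≤ t →
    ProbabilityTheory.IndepFun (fun ω => Z t ω - Z s ω)
      (fun ω => fun u : Set.Iic s => Z u.1 ω) (P w)

/-- First hitting time of the set `A` by the path `f` (∞ if never hit). -/
noncomputable def hitTime (f : ℝ → ℂ) (A : Set ℂ) : ENNReal :=
  sInf (ENNReal.ofReal '' {t : ℝ | 0 ≤ t ∧ f t ∈ A})

/-- First exit time of the path `f` from the set `D`. -/
noncomputable def exitTime (f : ℝ → ℂ) (D : Set ℂ) : ENNReal :=
  hitTime f Dᶜ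

/-- The path `f` exits the domain `D` (in finite time) through the set `B`. -/
def exitsInto (f : ℝ → ℂ) (D B : Set ℂ) : Prop :=
  ∃ t : ℝ, 0 ≤ t ∧ ENNReal.ofReal t = exitTime f D ∧ f t ∈ B

/-- Harmonic measure of `B` in `D` seen from `z`: the probability that Brownian
motion started at `z` exits `D` through `B`. -/
noncomputable def Hm {Ω : Type*} [MeasurableSpace Ω] (BM : PlanarBM Ω)
    (D B : Set ℂ) (z : ℂ) : ENNReal :=
  BM.P z {ω | exitsInto (fun t => BM.Z t ω) D B}

/-- `F` is an ℍ-hull: `F ⊆ ℍ`, `F` is relatively closed in ℍ, and `ℍ \ F` is a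
simply connected domain. -/
def IsHHull (F : Set ℂ) : Prop :=
  F ⊆ UH ∧ closure F ∩ UH = F ∧ SimplyConnectedSpace (UH \ F : Set ℂ)

/-- Carathéodory kernel convergence of domains with respect to the point `z₀`. -/
def KernelConvergesTo (D : ℕ → Set ℂ) (Dinf : Set ℂ) (z₀ : ℂ) : Prop :=
  (∀ K : Set ℂ, IsCompact K → K ⊆ Dinf → ∀ᶠ n in Filter.atTop, K ⊆ D n) ∧
  (∀ U : Set ℂ, IsOpen U → IsConnected U → z₀ ∈ U → {n | U ⊆ D n}.Infinite → U ⊆ Dinf)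

open scoped Classical in
/-- The imaginary part of the path `f` at the hitting time of `F`, provided `F`
is hit (in finite time) before the path leaves ℍ; zero otherwise (absorption). -/
noncomputable def imAtHit (f : ℝ → ℂ) (F : Set ℂ) : ℝ :=
  if h : ∃ t : ℝ, 0 ≤ t ∧ ENNReal.ofReal t = hitTime f F ∧ hitTime f F < exitTime f UH
  then (f h.choose).im else 0

/-- `hcap F = a`: the half-plane capacity of `F`, defined by
`hcap F = lim_{y→∞} y E_{iy}[Im Z_{σ_F}]` for absorbed Brownian motion in ℍ. -/
def HasHcap {Ω : Type*} [MeasurableSpace Ω] (BM : PlanarBM Ω) (F : Set ℂ) (a : ℝ) : Prop :=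
  Tendsto
    (fun y : ℝ => y * ∫ ω, imAtHit (fun t => BM.Z t ω) F ∂BM.P ((y : ℂ) * Complex.I))
    atTop (nhds a)

namespace HalfPlaneCapacity
open scoped NNReal ENNReal Topology

/-! ### Hitting of closed sets along paths -/

/-- The set `A` is approached along `w` at a countable dense set of times in `[0, s]`. -/
def HitBy (A : Set ℂ) (w : ℝ≥0 → ℂ) (s : ℝ≥0) : Prop :=
  ∀ m : ℕ, ∃ i : ℕ, w ((TopologicalSpace.denseSeq (Set.Icc (0 : ℝ≥0) 1) i : ℝ≥0) * s) ∈
    Metric.thickening (1 / ((m : ℝ) + 1)) A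

lemma hitBy_iff {A : Set ℂ} (hA : IsClosed A) {w : ℝ≥0 → ℂ} (hw : Continuous w) {s : ℝ≥0} :
    HitBy A w s ↔ ∃ r ≤ s, w r ∈ A := by
  constructor
  · intro h
    obtain ⟨r, hr, hmin⟩ := (isCompact_Icc (a := (0 : ℝ≥0)) (b := s)).exists_isMinOn
      (Set.nonempty_Icc.2 (zero_le)) (Metric.continuous_infEDist.comp hw
        : Continuous fun r => Metric.infEDist (w r) A).continuousOn
    refine ⟨r, hr.2, ?_⟩
    rw [← hA.closure_eq, Metric.mem_closure_iff_infEDist_zero]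
    by_contra hne
    obtain ⟨ε, hε, hlt⟩ : ∃ ε : ℝ, 0 < ε ∧ ENNReal.ofReal ε < Metric.infEDist (w r) A := by
      obtain ⟨q, hq0, hq⟩ := ENNReal.lt_iff_exists_real_btwn.1 (pos_iff_ne_zero.2 hne)
      exact ⟨q, by simpa using hq.1, hq.2⟩
    obtain ⟨m, hm⟩ := exists_nat_one_div_lt hε
    obtain ⟨i, hi⟩ := h m
    rw [Metric.mem_thickening_iff_infEDist_lt] at hi
    set d := TopologicalSpace.denseSeq (Set.Icc (0 : ℝ≥0) 1) i
    have h1 := hmin (a := (d : ℝ≥0) * s) ⟨zero_le, mul_le_of_le_one_left zero_le d.2.2⟩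
    simp only [Set.mem_ofPred_eq] at h1
    have := (hlt.trans_le h1).trans hi
    exact absurd (ENNReal.ofReal_le_ofReal hm.le) (not_le.2 this)
  · rintro ⟨r, hr, hrA⟩ m
    have hopen : IsOpen {x : Set.Icc (0 : ℝ≥0) 1 |
        w ((x : ℝ≥0) * s) ∈ Metric.thickening (1 / ((m : ℝ) + 1)) A} :=
      Metric.isOpen_thickening.preimage (hw.comp (by fun_prop))
    have hne : {x : Set.Icc (0 : ℝ≥0) 1 |
        w ((x : ℝ≥0) * s) ∈ Metric.thickening (1 / ((m : ℝ) + 1)) A}.Nonempty := by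
      have hmem : w r ∈ Metric.thickening (1 / ((m : ℝ) + 1)) A :=
        Metric.self_subset_thickening (by positivity) _ hrA
      by_cases hs : s = 0
      · refine ⟨⟨0, by simp⟩, ?_⟩
        subst hs
        simpa [nonpos_iff_eq_zero.1 hr] using hmem
      · refine ⟨⟨r / s, zero_le, div_le_one_of_le₀ hr zero_le⟩, ?_⟩
        simpa [div_mul_cancel₀ r hs] using hmem
    exact (TopologicalSpace.denseRange_denseSeq (Set.Icc (0 : ℝ≥0) 1)).exists_mem_open hopen hne

/-- The index of the first grid time `k * δ` by which `A` has been hit, capped at `N`. -/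
noncomputable def gridIdx (A : Set ℂ) (N : ℕ) (δ : ℝ≥0) (w : ℝ≥0 → ℂ) : ℕ :=
  sInf {k : ℕ | N ≤ k ∨ HitBy A w (k * δ)}

lemma gridIdx_le (A : Set ℂ) (N : ℕ) (δ : ℝ≥0) (w : ℝ≥0 → ℂ) : gridIdx A N δ w ≤ N :=
  Nat.sInf_le (Or.inl le_rfl)

lemma gridIdx_mem (A : Set ℂ) (N : ℕ) (δ : ℝ≥0) (w : ℝ≥0 → ℂ) :
    N ≤ gridIdx A N δ w ∨ HitBy A w (gridIdx A N δ w * δ) :=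
  Nat.sInf_mem (s := {k : ℕ | N ≤ k ∨ HitBy A w (k * δ)}) ⟨N, Or.inl le_rfl⟩

lemma gridIdx_eq_iff (A : Set ℂ) (N : ℕ) (δ : ℝ≥0) (w : ℝ≥0 → ℂ) (k : ℕ) :
    gridIdx A N δ w = k ↔
      (N ≤ k ∨ HitBy A w (k * δ)) ∧ ∀ j < k, ¬ (N ≤ j ∨ HitBy A w (j * δ)) := by
  constructor
  · rintro rfl
    exact ⟨gridIdx_mem A N δ w, fun j hj => Nat.notMem_of_lt_sInf hj⟩
  · rintro ⟨h1, h2⟩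
    refine le_antisymm (Nat.sInf_le h1) ?_
    by_contra! hlt
    exact h2 _ hlt (gridIdx_mem A N δ w)

/-- The first hitting time of `A`, capped at `T`. -/
noncomputable def capTime (A : Set ℂ) (T : ℝ≥0) (w : ℝ≥0 → ℂ) : ℝ≥0 :=
  sInf ({r | w r ∈ A} ∪ {T})

lemma capTime_le (A : Set ℂ) (T : ℝ≥0) (w : ℝ≥0 → ℂ) : capTime A T w ≤ T :=
  csInf_le (OrderBot.bddBelow _) (Or.inr rfl)

lemma capTime_le_of_mem {A : Set ℂ} (T : ℝ≥0) {w : ℝ≥0 → ℂ} {r : ℝ≥0} (h : w r ∈ A) :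
    capTime A T w ≤ r :=
  csInf_le (OrderBot.bddBelow _) (Or.inl h)

lemma notMem_of_lt_capTime {A : Set ℂ} {T : ℝ≥0} {w : ℝ≥0 → ℂ} {r : ℝ≥0}
    (h : r < capTime A T w) : w r ∉ A :=
  fun hr => absurd (capTime_le_of_mem T hr) (not_le.2 h)

lemma capTime_mem {A : Set ℂ} (hA : IsClosed A) (T : ℝ≥0) {w : ℝ≥0 → ℂ} (hw : Continuous w) :
    w (capTime A T w) ∈ A ∨ capTime A T w = T := by
  have h : capTime A T w ∈ {r | w r ∈ A} ∪ {T} :=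
    ((hA.preimage hw).union isClosed_singleton).csInf_mem ⟨T, Or.inr rfl⟩ (OrderBot.bddBelow _)
  exact h

lemma capTime_eq_of_not_hit {A : Set ℂ} {T : ℝ≥0} {w : ℝ≥0 → ℂ} (h : ∀ r ≤ T, w r ∉ A) :
    capTime A T w = T := by
  refine le_antisymm (capTime_le _ _ _) (le_csInf ⟨T, Or.inr rfl⟩ ?_)
  rintro b (hb | hb)
  · by_contra! hlt
    exact h b hlt.le hb
  · exact (Set.mem_singleton_iff.1 hb).ge

lemma capTime_mem_of_hit {A : Set ℂ} (hA : IsClosed A) {T : ℝ≥0} {w : ℝ≥0 → ℂ}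
    (hw : Continuous w) (h : ∃ r ≤ T, w r ∈ A) : w (capTime A T w) ∈ A := by
  rcases capTime_mem hA T hw with h1 | h1
  · exact h1
  · obtain ⟨r, hr, hrA⟩ := h
    have := capTime_le_of_mem T hrA
    rw [h1] at this ⊢
    rwa [le_antisymm this hr]

lemma capTime_eq_sInf {A : Set ℂ} {T : ℝ≥0} {w : ℝ≥0 → ℂ} (h : ∃ r ≤ T, w r ∈ A) :
    capTime A T w = sInf {r | w r ∈ A} := by
  obtain ⟨r, hr, hrA⟩ := h
  refine le_antisymm (le_csInf ⟨r, hrA⟩ fun b hb => capTime_le_of_mem T hb)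
    (le_csInf ⟨T, Or.inr rfl⟩ ?_)
  rintro b (hb | hb)
  · exact csInf_le (OrderBot.bddBelow _) hb
  · have h1 : sInf {r | w r ∈ A} ≤ r := csInf_le (OrderBot.bddBelow _) (show r ∈ {r | w r ∈ A} from hrA)
    exact h1.trans (hr.trans (Set.mem_singleton_iff.1 hb).ge)

lemma capTime_le_grid {A : Set ℂ} (hA : IsClosed A) (N : ℕ) (δ : ℝ≥0) {w : ℝ≥0 → ℂ}
    (hw : Continuous w) : capTime A (N * δ) w ≤ gridIdx A N δ w * δ := by
  rcases gridIdx_mem A N δ w with h | h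
  · exact (capTime_le _ _ _).trans (by gcongr)
  · obtain ⟨r, hr, hrA⟩ := (hitBy_iff hA hw).1 h
    exact (capTime_le_of_mem _ hrA).trans hr

lemma grid_le_capTime_add {A : Set ℂ} (hA : IsClosed A) (N : ℕ) (δ : ℝ≥0) {w : ℝ≥0 → ℂ}
    (hw : Continuous w) : (gridIdx A N δ w : ℝ≥0) * δ ≤ capTime A (N * δ) w + δ := by
  rcases Nat.eq_zero_or_pos (gridIdx A N δ w) with h0 | h0
  · simp [h0]
  obtain ⟨j, hj⟩ := Nat.exists_eq_add_of_lt h0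
  rw [zero_add] at hj
  have hlt := ((gridIdx_eq_iff A N δ w (j + 1)).1 hj).2 j (Nat.lt_succ_self j)
  push Not at hlt
  rw [hj]
  push_cast
  rw [add_mul, one_mul]
  gcongr
  rcases capTime_mem hA (N * δ) hw with h | h
  · by_contra! hc
    exact hlt.2 ((hitBy_iff hA hw).2 ⟨_, hc.le, h⟩)
  · rw [h]
    gcongr
    exact hlt.1.le

lemma tendsto_grid {A : Set ℂ} (hA : IsClosed A) (T : ℝ≥0) {w : ℝ≥0 → ℂ} (hw : Continuous w) :
    Tendsto (fun n : ℕ => (gridIdx A (n + 1) (T / (n + 1)) w : ℝ≥0) * (T / (n + 1))) atTop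
      (𝓝 (capTime A T w)) := by
  have hT : ∀ n : ℕ, ((n + 1 : ℕ) : ℝ≥0) * (T / (n + 1)) = T := fun n => by
    push_cast
    exact mul_div_cancel₀ T (by positivity)
  have hδ : Tendsto (fun n : ℕ => T / ((n : ℝ≥0) + 1)) atTop (𝓝 0) := by
    have h := (tendsto_one_div_add_atTop_nhds_zero_nat (𝕜 := ℝ)).const_mul (T : ℝ)
    rw [← NNReal.tendsto_coe]
    simpa [div_eq_mul_inv] using h
  refine tendsto_of_tendsto_of_tendsto_of_le_of_le tendsto_const_nhds
    (by simpa using tendsto_const_nhds.add hδ) (fun n => ?_) (fun n => ?_)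
  · have := capTime_le_grid hA (n + 1) (T / (n + 1)) hw
    rwa [hT n] at this
  · have := grid_le_capTime_add hA (n + 1) (T / (n + 1)) hw
    rwa [hT n] at this

open scoped Classical in
/-- The positive part of the height of `w` when it first hits `A`, zero if it never does. -/
noncomputable def hitVal (A : Set ℂ) (w : ℝ≥0 → ℂ) : ℝ :=
  if ∃ r, w r ∈ A then max (w (sInf {r | w r ∈ A})).im 0 else 0

lemma hitVal_nonneg (A : Set ℂ) (w : ℝ≥0 → ℂ) : 0 ≤ hitVal A w := by
  unfold hitVal
  split_ifs <;> simp

lemma hitVal_le {A : Set ℂ} (hA : IsClosed A) {M : ℝ} (hM : 0 ≤ M) (hAM : ∀ z ∈ A, z.im ≤ M)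
    {w : ℝ≥0 → ℂ} (hw : Continuous w) : hitVal A w ≤ M := by
  unfold hitVal
  split_ifs with h
  · exact max_le (hAM _ ((hA.preimage hw).csInf_mem h (OrderBot.bddBelow _))) hM
  · exact hM

lemma hitVal_of_not_hit {A : Set ℂ} {w : ℝ≥0 → ℂ} (h : ∀ r, w r ∉ A) : hitVal A w = 0 := by
  simp [hitVal, h]

lemma hitVal_eq_capTime {A : Set ℂ} {T : ℝ≥0} {w : ℝ≥0 → ℂ} (h : ∃ r ≤ T, w r ∈ A) :
    hitVal A w = max (w (capTime A T w)).im 0 := by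
  rw [capTime_eq_sInf h, hitVal, if_pos (h.imp fun _ => And.right)]

lemma hitVal_shift {A : Set ℂ} {w : ℝ≥0 → ℂ} {t : ℝ≥0} (h : ∀ r < t, w r ∉ A) :
    hitVal A (fun u => w (t + u)) = hitVal A w := by
  have hex : (∃ r, w (t + r) ∈ A) ↔ ∃ r, w r ∈ A := by
    refine ⟨fun ⟨r, hr⟩ => ⟨_, hr⟩, fun ⟨r, hr⟩ => ⟨r - t, ?_⟩⟩
    rwa [add_tsub_cancel_of_le (not_lt.1 fun hlt => h r hlt hr)]
  unfold hitVal
  rw [hex]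
  split_ifs with hh
  · have : t + sInf {r | w (t + r) ∈ A} = sInf {r | w r ∈ A} := by
      obtain ⟨r0, hr0⟩ := hex.2 hh
      refine le_antisymm (le_csInf hh fun r hr => ?_) ?_
      · have htr : t ≤ r := not_lt.1 fun hlt => h r hlt hr
        have : sInf {r | w (t + r) ∈ A} ≤ r - t :=
          csInf_le (OrderBot.bddBelow _) (by
            simpa [add_tsub_cancel_of_le htr] using hr)
        calc t + sInf {r | w (t + r) ∈ A} ≤ t + (r - t) := by gcongr
          _ = r := add_tsub_cancel_of_le htr
      · have htr : t ≤ sInf {r | w r ∈ A} := le_csInf hh fun r hr => not_lt.1 fun hlt => h r hlt hr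
        rw [← add_tsub_cancel_of_le htr]
        gcongr
        refine le_csInf ⟨r0, hr0⟩ fun r hr => ?_
        rw [tsub_le_iff_left]
        exact csInf_le (OrderBot.bddBelow _) hr
    simp only [this]
  · rfl

/-! ### Measurability of hitting functionals -/

lemma measurableSet_hitBy {Ω : Type*} {m : MeasurableSpace Ω} (A : Set ℂ) {X : ℝ≥0 → Ω → ℂ}
    {s : ℝ≥0} (hX : ∀ u ≤ s, Measurable (X u)) :
    MeasurableSet {ω | HitBy A (fun u => X u ω) s} := by
  have : {ω | HitBy A (fun u => X u ω) s} = ⋂ k : ℕ, ⋃ i : ℕ,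
      X ((TopologicalSpace.denseSeq (Set.Icc (0 : ℝ≥0) 1) i : ℝ≥0) * s) ⁻¹'
        Metric.thickening (1 / ((k : ℝ) + 1)) A := by
    ext ω
    simp [HitBy]
  rw [this]
  exact MeasurableSet.iInter fun k => MeasurableSet.iUnion fun i =>
    hX _ (mul_le_of_le_one_left zero_le (TopologicalSpace.denseSeq (Set.Icc (0 : ℝ≥0) 1) i).2.2)
      Metric.isOpen_thickening.measurableSet

lemma measurableSet_gridIdx_eq {Ω : Type*} {m : MeasurableSpace Ω} (A : Set ℂ)
    {X : ℝ≥0 → Ω → ℂ} (N : ℕ) (δ : ℝ≥0) (k : ℕ) (hX : ∀ u ≤ k * δ, Measurable (X u)) :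
    MeasurableSet {ω | gridIdx A N δ (fun u => X u ω) = k} := by
  have hj : ∀ j ≤ k, MeasurableSet {ω | N ≤ j ∨ HitBy A (fun u => X u ω) (j * δ)} := fun j hj =>
    (MeasurableSet.const _).union
      (measurableSet_hitBy A fun u hu => hX u (hu.trans (by gcongr)))
  have : {ω | gridIdx A N δ (fun u => X u ω) = k} =
      {ω | N ≤ k ∨ HitBy A (fun u => X u ω) (k * δ)} ∩
      ⋂ j ∈ Set.Iio k, {ω | N ≤ j ∨ HitBy A (fun u => X u ω) (j * δ)}ᶜ := by
    ext ω
    simp only [gridIdx_eq_iff, Set.mem_ofPred_eq, Set.mem_inter_iff, Set.mem_iInter,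
      Set.mem_compl_iff, Set.mem_Iio]
  rw [this]
  exact (hj k le_rfl).inter (MeasurableSet.biInter (Set.to_countable _) fun j hjk =>
    (hj j (le_of_lt hjk)).compl)

lemma measurableSet_hitBy_path (A : Set ℂ) (s : ℝ≥0) :
    MeasurableSet {w : ℝ≥0 → ℂ | HitBy A w s} :=
  measurableSet_hitBy (Ω := ℝ≥0 → ℂ) (X := fun u w => w u) A fun u _ => measurable_pi_apply u

lemma measurableSet_gridIdx_eq_path (A : Set ℂ) (N : ℕ) (δ : ℝ≥0) (k : ℕ) :
    MeasurableSet {w : ℝ≥0 → ℂ | gridIdx A N δ w = k} :=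
  measurableSet_gridIdx_eq (Ω := ℝ≥0 → ℂ) (X := fun u w => w u) A N δ k
    fun u _ => measurable_pi_apply u

lemma measurable_gridPos (A : Set ℂ) (N : ℕ) (δ : ℝ≥0) :
    Measurable fun w : ℝ≥0 → ℂ => w (gridIdx A N δ w * δ) := by
  have h1 : Measurable fun w : ℝ≥0 → ℂ => gridIdx A N δ w :=
    measurable_to_countable' fun k => measurableSet_gridIdx_eq_path A N δ k
  have h2 : Measurable fun p : (ℝ≥0 → ℂ) × ℕ => p.1 (p.2 * δ) :=
    measurable_from_prod_countable_left fun k => by exact measurable_pi_apply ((k : ℝ≥0) * δ)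
  exact h2.comp (measurable_id.prodMk h1)

open scoped Classical in
/-- Grid approximation of `hitVal`. -/
noncomputable def gridVal (A : Set ℂ) (n : ℕ) (w : ℝ≥0 → ℂ) : ℝ :=
  if HitBy A w (n + 1) then
    max (w (gridIdx A ((n + 1) * (n + 1)) (1 / (n + 1)) w * (1 / (n + 1)))).im 0 else 0

/-- A measurable version of `hitVal` on the space of all paths, truncated to `[0, M]`. -/
noncomputable def pathVal (A : Set ℂ) (M : ℝ) (w : ℝ≥0 → ℂ) : ℝ :=
  max 0 (min M (limsup (fun n => gridVal A n w) atTop))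

lemma measurable_pathVal (A : Set ℂ) (M : ℝ) : Measurable (pathVal A M) := by
  refine measurable_const.max (measurable_const.min (Measurable.limsup fun n => ?_))
  exact Measurable.ite (measurableSet_hitBy_path A _)
    ((Complex.measurable_im.comp (measurable_gridPos A _ _)).max measurable_const) measurable_const

lemma pathVal_nonneg (A : Set ℂ) (M : ℝ) (w : ℝ≥0 → ℂ) : 0 ≤ pathVal A M w := le_max_left _ _

lemma pathVal_le (A : Set ℂ) {M : ℝ} (hM : 0 ≤ M) (w : ℝ≥0 → ℂ) : pathVal A M w ≤ M :=
  max_le hM (min_le_left _ _)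

lemma tendsto_gridVal {A : Set ℂ} (hA : IsClosed A) {w : ℝ≥0 → ℂ} (hw : Continuous w) :
    Tendsto (fun n => gridVal A n w) atTop (𝓝 (hitVal A w)) := by
  by_cases h : ∃ r, w r ∈ A
  · obtain ⟨r, hr⟩ := h
    have hev : ∀ᶠ n : ℕ in atTop, r ≤ (n : ℝ≥0) + 1 := by
      obtain ⟨n0, hn0⟩ := exists_nat_ge r
      filter_upwards [eventually_ge_atTop n0] with n hn
      exact hn0.trans ((Nat.cast_le.2 hn).trans (by simp))
    have hδ : Tendsto (fun n : ℕ => 1 / ((n : ℝ≥0) + 1)) atTop (𝓝 0) := by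
      rw [← NNReal.tendsto_coe]
      simpa using tendsto_one_div_add_atTop_nhds_zero_nat (𝕜 := ℝ)
    have hup : Tendsto (fun n : ℕ => sInf {r | w r ∈ A} + 1 / ((n : ℝ≥0) + 1)) atTop
        (𝓝 (sInf {r | w r ∈ A})) := by
      have := (tendsto_const_nhds (x := sInf {r | w r ∈ A})).add hδ
      rwa [add_zero] at this
    have hT : ∀ n : ℕ, (((n + 1) * (n + 1) : ℕ) : ℝ≥0) * (1 / ((n : ℝ≥0) + 1)) = n + 1 := by
      intro n
      push_cast
      field_simp
    have hgrid : Tendsto (fun n : ℕ =>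
        (gridIdx A ((n + 1) * (n + 1)) (1 / (n + 1)) w : ℝ≥0) * (1 / (n + 1))) atTop
        (𝓝 (sInf {r | w r ∈ A})) := by
      refine tendsto_of_tendsto_of_tendsto_of_le_of_le' tendsto_const_nhds
        hup ?_ ?_
      · filter_upwards [hev] with n hn
        have := capTime_le_grid hA ((n + 1) * (n + 1)) (1 / (n + 1)) hw
        rwa [hT n, capTime_eq_sInf ⟨r, hn, hr⟩] at this
      · filter_upwards [hev] with n hn
        have := grid_le_capTime_add hA ((n + 1) * (n + 1)) (1 / (n + 1)) hw
        rwa [hT n, capTime_eq_sInf ⟨r, hn, hr⟩] at this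
    have h1 : hitVal A w = max (w (sInf {r | w r ∈ A})).im 0 := if_pos ⟨r, hr⟩
    rw [h1]
    refine Tendsto.congr' ?_ (((Complex.continuous_im.tendsto _).comp
      ((hw.tendsto _).comp hgrid)).max tendsto_const_nhds)
    filter_upwards [hev] with n hn
    simp only [gridVal, if_pos ((hitBy_iff hA hw).2 ⟨r, hn, hr⟩), Function.comp]
  · push Not at h
    rw [hitVal_of_not_hit h]
    refine tendsto_const_nhds.congr fun n => ?_
    rw [gridVal, if_neg]
    rw [hitBy_iff hA hw]
    rintro ⟨r, -, hr⟩
    exact h r hr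

lemma pathVal_eq {A : Set ℂ} (hA : IsClosed A) {M : ℝ} (hM : 0 ≤ M) (hAM : ∀ z ∈ A, z.im ≤ M)
    {w : ℝ≥0 → ℂ} (hw : Continuous w) : pathVal A M w = hitVal A w := by
  rw [pathVal, (tendsto_gridVal hA hw).limsup_eq, min_eq_right (hitVal_le hA hM hAM hw),
    max_eq_right (hitVal_nonneg A w)]

/-! ### The absorbing set of a hull -/

/-- The hull together with the closed lower half-plane. -/
def absorbing (F : Set ℂ) : Set ℂ := F ∪ {z | z.im ≤ 0}

lemma isClosed_absorbing {F : Set ℂ} (hF : closure F ∩ UH = F) : IsClosed (absorbing F) := by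
  have h : absorbing F = closure F ∪ {z | z.im ≤ 0} := by
    ext z
    constructor
    · rintro (h | h)
      · exact Or.inl (subset_closure h)
      · exact Or.inr h
    · rintro (h | h)
      · by_cases hz : 0 < z.im
        · exact Or.inl (hF ▸ ⟨h, hz⟩)
        · exact Or.inr (not_lt.1 hz)
      · exact Or.inr h
  rw [h]
  exact isClosed_closure.union (isClosed_le Complex.continuous_im continuous_const)

lemma hitTime_le {f : ℝ → ℂ} {B : Set ℂ} {r : ℝ≥0} (h : f r ∈ B) : hitTime f B ≤ r :=
  sInf_le ⟨r, ⟨r.2, h⟩, by simp⟩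

lemma le_hitTime {f : ℝ → ℂ} {B : Set ℂ} {c : ℝ≥0∞} (h : ∀ r : ℝ≥0, f r ∈ B → c ≤ r) :
    c ≤ hitTime f B := by
  refine le_sInf ?_
  rintro _ ⟨t, ⟨ht, htB⟩, rfl⟩
  rw [ENNReal.ofReal_eq_coe_nnreal ht]
  exact h ⟨t, ht⟩ htB

lemma imAtHit_eq_hitVal {F : Set ℂ} (hFU : F ⊆ UH) (hF : closure F ∩ UH = F) {f : ℝ → ℂ}
    (hf : Continuous f) : imAtHit f F = hitVal (absorbing F) (fun u : ℝ≥0 => f u) := by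
  have hA := isClosed_absorbing hF
  have hw : Continuous fun u : ℝ≥0 => f u := hf.comp NNReal.continuous_coe
  by_cases h : ∃ r : ℝ≥0, f r ∈ absorbing F
  · have hmem : f (sInf {r : ℝ≥0 | f r ∈ absorbing F} : ℝ≥0) ∈ absorbing F :=
      (hA.preimage hw).csInf_mem h (OrderBot.bddBelow _)
    have hle : ∀ r : ℝ≥0, f r ∈ absorbing F → sInf {r : ℝ≥0 | f r ∈ absorbing F} ≤ r :=
      fun r hr => csInf_le (OrderBot.bddBelow _) hr
    rw [hitVal, if_pos h]
    set S := sInf {r : ℝ≥0 | f r ∈ absorbing F} with hS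
    by_cases hSF : f S ∈ F
    · have h1 : hitTime f F = S := le_antisymm (hitTime_le hSF)
        (le_hitTime fun r hr => by exact_mod_cast hle r (Or.inl hr))
      have h2 : hitTime f F < exitTime f UH := by
        rw [h1, exitTime]
        by_cases hex : ∃ r : ℝ≥0, f r ∈ UHᶜ
        · have hK : IsClosed {r : ℝ≥0 | f r ∈ UHᶜ} :=
            (isOpen_lt continuous_const Complex.continuous_im).isClosed_compl.preimage hw
          have h0 : f (sInf {r : ℝ≥0 | f r ∈ UHᶜ} : ℝ≥0) ∈ UHᶜ :=
            hK.csInf_mem hex (OrderBot.bddBelow _)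
          have hlt : S < sInf {r : ℝ≥0 | f r ∈ UHᶜ} := by
            refine lt_of_le_of_ne (hle _ (Or.inr (not_lt.1 (show ¬ 0 < (f _).im from h0)))) fun he => ?_
            rw [← he] at h0
            exact h0 (hFU hSF)
          refine lt_of_lt_of_le (ENNReal.coe_lt_coe.2 hlt) (le_hitTime fun r hr => ?_)
          exact_mod_cast csInf_le (OrderBot.bddBelow _) (show r ∈ {r : ℝ≥0 | f r ∈ UHᶜ} from hr)
        · refine lt_of_lt_of_le ENNReal.coe_lt_top (le_hitTime fun r hr => (hex ⟨r, hr⟩).elim)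
      have h3 : ∃ t : ℝ, 0 ≤ t ∧ ENNReal.ofReal t = hitTime f F ∧ hitTime f F < exitTime f UH :=
        ⟨S, S.2, by rw [h1]; simp, h2⟩
      rw [imAtHit, dif_pos h3]
      obtain ⟨h4, h5, -⟩ := h3.choose_spec
      have h6 : h3.choose = S := by
        have := congrArg ENNReal.toReal (h5.trans h1)
        rwa [ENNReal.toReal_ofReal h4, ENNReal.coe_toReal] at this
      rw [h6, max_eq_left (le_of_lt (hFU hSF))]
    · have him : (f S).im ≤ 0 := hmem.resolve_left hSF
      rw [max_eq_right him, imAtHit, dif_neg]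
      rintro ⟨t, -, -, h2⟩
      refine absurd h2 (not_lt.2 ?_)
      calc exitTime f UH ≤ S := hitTime_le (not_lt.2 him)
        _ ≤ hitTime f F := le_hitTime fun r hr => by exact_mod_cast hle r (Or.inl hr)
  · push Not at h
    rw [hitVal_of_not_hit h, imAtHit, dif_neg]
    rintro ⟨t, ht, -, h2⟩
    have : (⊤ : ℝ≥0∞) ≤ hitTime f F := le_hitTime fun r hr => (h r (Or.inl hr)).elim
    exact absurd h2 (not_lt.2 (le_top.trans this))

/-! ### Brownian path laws and the Markov property -/

/-- The law of the increment of planar Brownian motion over a time interval of length `v`. -/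
noncomputable def gam (v : ℝ≥0) : Measure ℂ :=
  ((ProbabilityTheory.gaussianReal 0 v).prod (ProbabilityTheory.gaussianReal 0 v)).map
    fun p : ℝ × ℝ => Complex.equivRealProd.symm p

lemma measurable_equivRealProd_symm :
    Measurable fun p : ℝ × ℝ => Complex.equivRealProd.symm p :=
  Complex.measurableEquivRealProd.symm.measurable

instance isProbabilityMeasure_gam (v : ℝ≥0) : IsProbabilityMeasure (gam v) :=
  Measure.isProbabilityMeasure_map measurable_equivRealProd_symm.aemeasurable

/-- The path `w` stopped at time `s`. -/
def stopAt (s : ℝ≥0) (w : ℝ≥0 → ℂ) : ℝ≥0 → ℂ := fun u => w (min u s)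

lemma measurable_stopAt (s : ℝ≥0) : Measurable (stopAt s) :=
  measurable_pi_lambda _ fun u => measurable_pi_apply (min u s)

lemma measurable_eval_sub (a b : ℝ≥0) : Measurable fun w : ℝ≥0 → ℂ => w a - w b :=
  (measurable_pi_apply a).sub (measurable_pi_apply b)

lemma measurable_stopAt_prod (s t : ℝ≥0) :
    Measurable fun w : ℝ≥0 → ℂ => (stopAt s w, w t - w s) :=
  (measurable_stopAt s).prodMk (measurable_eval_sub t s)

/-- A finite measure on path space with start at `0` and independent Gaussian increments. -/
structure IsBMLaw (ν : Measure (ℝ≥0 → ℂ)) : Prop where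
  fin : IsFiniteMeasure ν
  start : ∀ᵐ w ∂ν, w 0 = 0
  indep : ∀ s t : ℝ≥0, s ≤ t → ν.map (fun w => (stopAt s w, w t - w s)) =
    (ν.map (stopAt s)).prod (gam (t - s))

open scoped Classical in
/-- The path `w` with all values outside of times in `I` replaced by zero. -/
noncomputable def keep (I : Finset ℝ≥0) (w : ℝ≥0 → ℂ) : ℝ≥0 → ℂ :=
  fun u => if u ∈ I then w u else 0

lemma measurable_keep (I : Finset ℝ≥0) : Measurable (keep I) := by
  refine measurable_pi_lambda _ fun u => ?_
  by_cases h : u ∈ I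
  · simpa [keep, h] using measurable_pi_apply u
  · simp [keep, h]

open scoped Classical in
lemma IsBMLaw.map_keep_insert {ν : Measure (ℝ≥0 → ℂ)} (h : IsBMLaw ν) (I : Finset ℝ≥0) (a : ℝ≥0)
    (ha : ∀ x ∈ I, x < a) :
    ν.map (keep (insert a I)) = ((ν.map (keep I)).prod (gam (a - I.sup id))).map
      (fun p => Function.update p.1 a (p.1 (I.sup id) + p.2)) := by
  have := h.fin
  set m := I.sup id with hm
  have hmle : ∀ x ∈ I, x ≤ m := fun x hx => Finset.le_sup (f := id) hx
  have hma : m ≤ a := Finset.sup_le fun x hx => (ha x hx).le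
  have hΦ : Measurable fun p : (ℝ≥0 → ℂ) × ℂ => Function.update p.1 a (p.1 m + p.2) := by
    refine measurable_pi_lambda _ fun u => ?_
    by_cases hu : u = a
    · subst hu
      simp only [Function.update_self]
      exact ((measurable_pi_apply m).comp measurable_fst).add measurable_snd
    · simp only [Function.update_of_ne hu]
      exact (measurable_pi_apply u).comp measurable_fst
  have hks : ∀ w, keep I (stopAt m w) = keep I w := by
    intro w
    ext u
    by_cases hu : u ∈ I
    · simp [keep, hu, stopAt, min_eq_left (hmle u hu)]
    · simp [keep, hu]
  have h1 : (ν.map (keep I)).prod (gam (a - m)) =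
      ν.map (fun w => (keep I w, w a - w m)) := by
    have h2 : (ν.map (keep I)).prod (gam (a - m)) =
        ((ν.map (stopAt m)).prod (gam (a - m))).map (Prod.map (keep I) id) := by
      rw [← Measure.map_prod_map _ _ (measurable_keep I) measurable_id, Measure.map_id,
        Measure.map_map (measurable_keep I) (measurable_stopAt m)]
      congr 2
      ext1 w
      exact (hks w).symm
    rw [h2, ← h.indep m a hma, Measure.map_map ((measurable_keep I).prodMap measurable_id)
      (measurable_stopAt_prod m a)]
    congr 1
    ext1 w
    simp [hks w]
  rw [h1, Measure.map_map hΦ ((measurable_keep I).prodMk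
    (measurable_eval_sub a m))]
  refine Measure.map_congr ?_
  filter_upwards [h.start] with w hw
  have hkm : keep I w m = w m := by
    by_cases hmI : m ∈ I
    · simp [keep, hmI]
    · have hI : I = ∅ := by
        by_contra hne
        obtain ⟨x, hx, hxm⟩ := Finset.exists_mem_eq_sup I (Finset.nonempty_iff_ne_empty.2 hne) id
        exact hmI (by rw [hm, hxm]; exact hx)
      have hm0 : m = 0 := by simp [hm, hI]
      simp [keep, hI, hm0, hw]
  ext u
  simp only [Function.comp, hkm, add_sub_cancel]
  by_cases hu : u = a
  · simp [hu, keep]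
  · simp [keep, hu]

lemma IsBMLaw.unique {ν μ : Measure (ℝ≥0 → ℂ)} (hν : IsBMLaw ν) (hμ : IsBMLaw μ)
    (h : ν Set.univ = μ Set.univ) : ν = μ := by
  classical
  have := hν.fin
  have := hμ.fin
  have key : ∀ I : Finset ℝ≥0, ν.map (keep I) = μ.map (keep I) := by
    intro I
    induction I using Finset.induction_on_max with
    | empty =>
      have : keep ∅ = fun _ => 0 := by ext w u; simp [keep]
      rw [this, Measure.map_const, Measure.map_const, h]
    | insert a I ha ih => rw [hν.map_keep_insert I a ha, hμ.map_keep_insert I a ha, ih]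
  have hr : ∀ I : Finset ℝ≥0, (I.restrict : (ℝ≥0 → ℂ) → (I → ℂ)) = I.restrict ∘ keep I := by
    intro I
    ext w u
    simp [keep]
  have hproj : ∀ I : Finset ℝ≥0, μ.map I.restrict = ν.map (I.restrict : (ℝ≥0 → ℂ) → (I → ℂ)) := by
    intro I
    rw [hr I, ← Measure.map_map (Finset.measurable_restrict I) (measurable_keep I),
      ← Measure.map_map (Finset.measurable_restrict I) (measurable_keep I), key I]
  exact IsProjectiveLimit.unique (P := fun I : Finset ℝ≥0 => ν.map I.restrict)
    (fun I => rfl) (fun I => hproj I)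

lemma IsBMLaw.smul {ν : Measure (ℝ≥0 → ℂ)} (h : IsBMLaw ν) {c : ℝ≥0∞} (hc : c ≠ ∞) :
    IsBMLaw (c • ν) where
  fin := by
    have := h.fin
    exact ν.smul_finite hc
  start := Measure.ae_smul_measure h.start c
  indep s t hst := by
    have := h.fin
    rw [Measure.map_smul, Measure.map_smul, h.indep s t hst, Measure.prod_smul_left]

/-- `X` is, under `P`, a planar Brownian motion started at `z` with all paths continuous. -/
structure IsBM {Ω : Type*} [MeasurableSpace Ω] (P : Measure Ω) (X : Ω → ℝ≥0 → ℂ) (z : ℂ) :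
    Prop where
  prob : IsProbabilityMeasure P
  meas : Measurable X
  cont : ∀ ω, Continuous (X ω)
  start : ∀ ω, X ω 0 = z
  indep : ∀ s t : ℝ≥0, s ≤ t → P.map (fun ω => (stopAt s (X ω), X ω t - X ω s)) =
    (P.map fun ω => stopAt s (X ω)).prod (gam (t - s))

section
variable {Ω : Type*}

/-- Events depending on the path up to time `s`. -/
@[reducible] noncomputable def past (X : Ω → ℝ≥0 → ℂ) (s : ℝ≥0) : MeasurableSpace Ω :=
  MeasurableSpace.comap (fun ω => stopAt s (X ω)) inferInstance

lemma measurable_past (X : Ω → ℝ≥0 → ℂ) {u s : ℝ≥0} (h : u ≤ s) :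
    Measurable[past X s] fun ω => X ω u := by
  have h1 : Measurable[past X s] fun ω => stopAt s (X ω) := comap_measurable _
  have h2 := (measurable_pi_apply u).comp h1
  simpa [Function.comp_def, stopAt, min_eq_left h] using h2

lemma past_mono (X : Ω → ℝ≥0 → ℂ) {s t : ℝ≥0} (h : s ≤ t) : past X s ≤ past X t := by
  have : Measurable[past X t] fun ω => stopAt s (X ω) := by
    refine @measurable_pi_lambda _ _ _ (past X t) _ _ fun u => ?_
    exact measurable_past X ((min_le_right u s).trans h)
  exact this.comap_le

variable [MeasurableSpace Ω] {P : Measure Ω} {X : Ω → ℝ≥0 → ℂ} {z : ℂ}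

lemma IsBM.measurable_eval (h : IsBM P X z) (t : ℝ≥0) : Measurable fun ω => X ω t :=
  (measurable_pi_apply t).comp h.meas

lemma IsBM.past_le (h : IsBM P X z) (s : ℝ≥0) : past X s ≤ ‹MeasurableSpace Ω› :=
  ((measurable_stopAt s).comp h.meas).comap_le

lemma IsBM.measure_inter (h : IsBM P X z) {s t : ℝ≥0} (hst : s ≤ t) {B : Set Ω}
    (hB : MeasurableSet[past X s] B) {C : Set ℂ} (hC : MeasurableSet C) :
    P (B ∩ {ω | X ω t - X ω s ∈ C}) = P B * gam (t - s) C := by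
  have := h.prob
  obtain ⟨S, hS, rfl⟩ := hB
  have h1 := congrArg (fun m => m (S ×ˢ C)) (h.indep s t hst)
  have hm : Measurable fun ω => (stopAt s (X ω), X ω t - X ω s) :=
    (measurable_stopAt_prod s t).comp h.meas
  have hm' : Measurable fun ω => stopAt s (X ω) := (measurable_stopAt s).comp h.meas
  rw [Measure.map_apply hm (hS.prod hC), Measure.prod_prod, Measure.map_apply hm' hS] at h1
  exact h1

/-- The increments of `w` after time `t`. -/
def incr (t : ℝ≥0) (w : ℝ≥0 → ℂ) : ℝ≥0 → ℂ := fun u => w (t + u) - w t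

lemma measurable_incr (t : ℝ≥0) : Measurable (incr t) :=
  measurable_pi_lambda _ fun u => (measurable_pi_apply (t + u)).sub (measurable_pi_apply t)

lemma IsBM.isBMLaw_incr (h : IsBM P X z) {t : ℝ≥0} {B : Set Ω} (hB : MeasurableSet[past X t] B) :
    IsBMLaw ((P.restrict B).map fun ω => incr t (X ω)) := by
  have := h.prob
  have hm : Measurable fun ω => incr t (X ω) := (measurable_incr t).comp h.meas
  refine ⟨inferInstance, ?_, ?_⟩
  · rw [ae_map_iff hm.aemeasurable (measurableSet_eq_fun (measurable_pi_apply 0) measurable_const)]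
    exact Eventually.of_forall fun ω => by simp [incr]
  · intro s s' hs
    symm
    refine Measure.prod_eq fun S C hS hC => ?_
    rw [Measure.map_apply (measurable_stopAt_prod s s') (hS.prod hC), Measure.map_apply (measurable_stopAt s) hS,
      Measure.map_apply hm (measurable_stopAt s hS), Measure.map_apply hm
        (measurable_stopAt_prod s s' (hS.prod hC)),
      Measure.restrict_apply (hm (measurable_stopAt s hS)), Measure.restrict_apply
        (hm (measurable_stopAt_prod s s' (hS.prod hC)))]
    have hB' : MeasurableSet[past X (t + s)]
        ((fun ω => incr t (X ω)) ⁻¹' ((stopAt s) ⁻¹' S) ∩ B) := by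
      refine MeasurableSet.inter ?_ (past_mono X (le_self_add) _ hB)
      have h1 : Measurable[past X (t + s)] fun ω => stopAt s (incr t (X ω)) := by
        refine @measurable_pi_lambda _ _ _ (past X (t + s)) _ _ fun u => ?_
        exact (measurable_past X (by gcongr; exact min_le_right u s)).sub
          (measurable_past X le_self_add)
      exact h1 hS
    have h2 := h.measure_inter (show t + s ≤ t + s' by gcongr) hB' hC
    rw [add_tsub_add_eq_tsub_left] at h2
    rw [← h2]
    congr 1
    ext ω
    simp [incr, Set.mem_inter_iff]
    tauto

/-- **Markov property** at a deterministic time. -/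
lemma IsBM.map_prod_incr (h : IsBM P X z) {Λ : Measure (ℝ≥0 → ℂ)} (hΛ : IsBMLaw Λ)
    [IsProbabilityMeasure Λ] {t : ℝ≥0} {B : Set Ω} (hB : MeasurableSet[past X t] B) :
    (P.restrict B).map (fun ω => (X ω t, incr t (X ω))) =
      ((P.restrict B).map fun ω => X ω t).prod Λ := by
  have := h.prob
  have hm : Measurable fun ω => incr t (X ω) := (measurable_incr t).comp h.meas
  symm
  refine Measure.prod_eq fun C S hC hS => ?_
  have hBC : MeasurableSet[past X t] ((fun ω => X ω t) ⁻¹' C ∩ B) :=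
    (measurable_past X le_rfl hC).inter hB
  have h1 : (P.restrict ((fun ω => X ω t) ⁻¹' C ∩ B)).map (fun ω => incr t (X ω)) =
      P ((fun ω => X ω t) ⁻¹' C ∩ B) • Λ := by
    refine (h.isBMLaw_incr hBC).unique (hΛ.smul (measure_ne_top _ _)) ?_
    rw [Measure.map_apply hm MeasurableSet.univ]
    simp
  have h2 := congrArg (fun m => m S) h1
  simp only [Measure.smul_apply, smul_eq_mul] at h2
  rw [Measure.map_apply hm hS, Measure.restrict_apply (hm hS)] at h2
  rw [Measure.map_apply ((h.measurable_eval t).prodMk hm) (hC.prod hS),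
    Measure.map_apply (h.measurable_eval t) hC, Measure.restrict_apply (h.measurable_eval t hC),
    Measure.restrict_apply (((h.measurable_eval t).prodMk hm) (hC.prod hS)), ← h2]
  congr 1
  ext ω
  simp [Set.mem_inter_iff]
  tauto

end

lemma exists_isBM {Ω : Type*} [MeasurableSpace Ω] (BM : PlanarBM Ω) (z : ℂ) :
    ∃ X : Ω → ℝ≥0 → ℂ, IsBM (BM.P z) X z ∧
      ∀ᵐ ω ∂BM.P z, Continuous (fun t => BM.Z t ω) ∧ ∀ u : ℝ≥0, X ω u = BM.Z u ω := by
  classical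
  have hp := BM.isProb z
  set N : Set Ω := toMeasurable (BM.P z) {ω | ¬ (Continuous (fun t => BM.Z t ω) ∧ BM.Z 0 ω = z)}
    with hN
  have hN0 : BM.P z N = 0 := by
    rw [hN, measure_toMeasurable]
    exact (BM.contPaths z).and (BM.start z)
  have hNm : MeasurableSet N := measurableSet_toMeasurable _ _
  have hNc : ∀ ω, ω ∉ N → Continuous (fun t => BM.Z t ω) ∧ BM.Z 0 ω = z := by
    intro ω hω
    by_contra hc
    exact hω (subset_toMeasurable _ _ hc)
  have hae : ∀ᵐ ω ∂BM.P z, ω ∉ N := measure_eq_zero_iff_ae_notMem.1 hN0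
  have hpath : Measurable fun ω => fun u : ℝ≥0 => BM.Z u ω :=
    measurable_pi_lambda _ fun u => BM.meas u
  let X : Ω → ℝ≥0 → ℂ := fun ω => if ω ∈ N then fun _ => z else fun u => BM.Z u ω
  have hXm : Measurable X := Measurable.ite hNm measurable_const hpath
  have hXN : ∀ ω, ω ∉ N → X ω = fun u : ℝ≥0 => BM.Z u ω := fun ω hω => if_neg hω
  refine ⟨X, ⟨hp, hXm, ?_, ?_, ?_⟩, ?_⟩
  · intro ω
    by_cases hω : ω ∈ N
    · simp only [X, if_pos hω]
      exact continuous_const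
    · rw [hXN ω hω]
      exact (hNc ω hω).1.comp NNReal.continuous_coe
  · intro ω
    by_cases hω : ω ∈ N
    · simp only [X, if_pos hω]
    · rw [hXN ω hω]
      exact (hNc ω hω).2
  · intro s t hst
    have hst' : (s : ℝ) ≤ t := hst
    have h1 : (fun ω => (stopAt s (X ω), X ω t - X ω s)) =ᵐ[BM.P z]
        fun ω => (stopAt s (fun u : ℝ≥0 => BM.Z u ω), BM.Z t ω - BM.Z s ω) := by
      filter_upwards [hae] with ω hω
      rw [hXN ω hω]
    have h2 : (fun ω => stopAt s (X ω)) =ᵐ[BM.P z]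
        fun ω => stopAt s (fun u : ℝ≥0 => BM.Z u ω) := by
      filter_upwards [hae] with ω hω
      rw [hXN ω hω]
    rw [Measure.map_congr h1, Measure.map_congr h2]
    have hg : Measurable fun (y : Set.Iic (s : ℝ) → ℂ) => fun u : ℝ≥0 =>
        y ⟨(min u s : ℝ≥0), NNReal.coe_le_coe.2 (min_le_right u s)⟩ :=
      measurable_pi_lambda _ fun u => measurable_pi_apply _
    have h3 := ((BM.indepIncr z s t s.2 hst').comp measurable_id hg).symm
    have h4 : Measurable fun ω => stopAt s (fun u : ℝ≥0 => BM.Z u ω) :=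
      (measurable_stopAt s).comp hpath
    have h5 : Measurable fun ω => BM.Z t ω - BM.Z s ω := (BM.meas t).sub (BM.meas s)
    have h6 := (ProbabilityTheory.indepFun_iff_map_prod_eq_prod_map_map h4.aemeasurable
      h5.aemeasurable).1 h3
    have h7 : (BM.P z).map (fun ω => BM.Z t ω - BM.Z s ω) = gam (t - s) := by
      rw [BM.incrLaw z s t s.2 hst', gam, ← NNReal.coe_sub hst, Real.toNNReal_coe]
    rw [h7] at h6
    exact h6
  · filter_upwards [hae] with ω hω
    exact ⟨(hNc ω hω).1, fun u => by rw [hXN ω hω]⟩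

lemma IsBM.exists_law {Ω : Type*} [MeasurableSpace Ω] {P : Measure Ω} {X : Ω → ℝ≥0 → ℂ} {z : ℂ}
    (h : IsBM P X z) : ∃ Λ : Measure (ℝ≥0 → ℂ), IsProbabilityMeasure Λ ∧ IsBMLaw Λ := by
  have := h.prob
  have h1 := h.isBMLaw_incr (t := 0) (B := Set.univ) (@MeasurableSet.univ _ (past X 0))
  rw [Measure.restrict_univ] at h1
  exact ⟨_, Measure.isProbabilityMeasure_map ((measurable_incr 0).comp h.meas).aemeasurable, h1⟩

/-- The expectation of the functional `G` along a Brownian path with increment law `Λ`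
started at `x`. -/
noncomputable def avg (Λ : Measure (ℝ≥0 → ℂ)) (G : (ℝ≥0 → ℂ) → ℝ) (x : ℂ) : ℝ :=
  ∫ w, G (fun u => x + w u) ∂Λ

section
variable {Λ : Measure (ℝ≥0 → ℂ)} {G : (ℝ≥0 → ℂ) → ℝ} {M : ℝ}

lemma avg_nonneg (h0 : ∀ w, 0 ≤ G w) (x : ℂ) : 0 ≤ avg Λ G x := integral_nonneg fun _ => h0 _

variable [IsProbabilityMeasure Λ]

lemma measurable_translate : Measurable fun p : ℂ × (ℝ≥0 → ℂ) => fun u => p.1 + p.2 u :=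
  measurable_pi_lambda _ fun u => measurable_fst.add ((measurable_pi_apply u).comp measurable_snd)

lemma measurable_avg (hG : Measurable G) : Measurable (avg Λ G) := by
  have : StronglyMeasurable fun p : ℂ × (ℝ≥0 → ℂ) => G (fun u => p.1 + p.2 u) :=
    (hG.comp measurable_translate).stronglyMeasurable
  exact this.integral_prod_right.measurable

lemma avg_le (hG : Measurable G) (h0 : ∀ w, 0 ≤ G w) (hM : ∀ w, G w ≤ M) (x : ℂ) :
    avg Λ G x ≤ M := by
  have hi : Integrable (fun w : ℝ≥0 → ℂ => G (fun u => x + w u)) Λ :=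
    Integrable.of_bound (hG.comp (measurable_translate.comp
      (measurable_const.prodMk measurable_id))).aestronglyMeasurable M
      (Eventually.of_forall fun w => by rw [Real.norm_of_nonneg (h0 _)]; exact hM _)
  calc avg Λ G x ≤ ∫ _, M ∂Λ := integral_mono hi (integrable_const M) fun w => hM _
    _ = M := by simp

variable {Ω : Type*} [MeasurableSpace Ω] {P : Measure Ω} {X : Ω → ℝ≥0 → ℂ} {z : ℂ}

/-- The Markov property in integral form. -/
lemma IsBM.setIntegral_shift (h : IsBM P X z) (hΛ : IsBMLaw Λ) (hG : Measurable G)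
    (h0 : ∀ w, 0 ≤ G w) (hM : ∀ w, G w ≤ M) {t : ℝ≥0} {B : Set Ω}
    (hB : MeasurableSet[past X t] B) :
    ∫ ω in B, G (fun u => X ω (t + u)) ∂P = ∫ ω in B, avg Λ G (X ω t) ∂P := by
  have := h.prob
  have hm : Measurable fun ω => (X ω t, incr t (X ω)) :=
    (h.measurable_eval t).prodMk ((measurable_incr t).comp h.meas)
  have hGt : Measurable fun p : ℂ × (ℝ≥0 → ℂ) => G (fun u => p.1 + p.2 u) :=
    hG.comp measurable_translate
  have h1 : ∫ ω in B, G (fun u => X ω (t + u)) ∂P =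
      ∫ p, G (fun u => p.1 + p.2 u) ∂((P.restrict B).map fun ω => (X ω t, incr t (X ω))) := by
    rw [integral_map hm.aemeasurable hGt.aestronglyMeasurable]
    simp [incr]
  rw [h1, h.map_prod_incr hΛ hB, integral_prod _ (Integrable.of_bound hGt.aestronglyMeasurable M
    (Eventually.of_forall fun w => by rw [Real.norm_of_nonneg (h0 _)]; exact hM _)),
    integral_map (h.measurable_eval t).aemeasurable]
  · rfl
  · exact (measurable_avg hG).aestronglyMeasurable

lemma IsBM.integral_eq_avg (h : IsBM P X z) (hΛ : IsBMLaw Λ) (hG : Measurable G)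
    (h0 : ∀ w, 0 ≤ G w) (hM : ∀ w, G w ≤ M) : ∫ ω, G (X ω) ∂P = avg Λ G z := by
  have := h.prob
  have h1 := h.setIntegral_shift hΛ hG h0 hM (t := 0) (@MeasurableSet.univ _ (past X 0))
  simpa [h.start] using h1

end

/-! ### The strong Markov property at capped hitting times -/

section
variable {Ω : Type*}

lemma measurableSet_past_gridIdx (X : Ω → ℝ≥0 → ℂ) (A : Set ℂ) (N : ℕ) (δ : ℝ≥0) (k : ℕ) :
    MeasurableSet[past X (k * δ)] {ω | gridIdx A N δ (X ω) = k} :=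
  @measurableSet_gridIdx_eq Ω (past X (k * δ)) A (fun u ω => X ω u) N δ k
    fun _ hu => measurable_past X hu

variable [MeasurableSpace Ω] {P : Measure Ω} {X : Ω → ℝ≥0 → ℂ} {z : ℂ}

lemma IsBM.eq_sum_restrict (h : IsBM P X z) (A : Set ℂ) (N : ℕ) (δ : ℝ≥0) :
    P = Measure.sum fun k : ℕ => P.restrict {ω | gridIdx A N δ (X ω) = k} := by
  have hu : ⋃ k : ℕ, {ω | gridIdx A N δ (X ω) = k} = Set.univ := by
    ext ω
    simp
  rw [← Measure.restrict_iUnion, hu, Measure.restrict_univ]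
  · intro i j hij
    refine Set.disjoint_left.2 fun ω hi hj => hij ?_
    exact (show gridIdx A N δ (X ω) = i from hi).symm.trans hj
  · exact fun k => h.past_le _ _ (measurableSet_past_gridIdx X A N δ k)

lemma IsBM.measurable_gridIdx (h : IsBM P X z) (A : Set ℂ) (N : ℕ) (δ : ℝ≥0) :
    Measurable fun ω => gridIdx A N δ (X ω) :=
  measurable_to_countable' fun k => h.past_le _ _ (measurableSet_past_gridIdx X A N δ k)

lemma IsBM.measurable_comp_gridIdx (h : IsBM P X z) (A : Set ℂ) (N : ℕ) (δ : ℝ≥0)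
    {β : Type*} [MeasurableSpace β] {f : ℝ≥0 → Ω → β} (hf : ∀ t, Measurable (f t)) :
    Measurable fun ω => f (gridIdx A N δ (X ω) * δ) ω := by
  have h1 : Measurable fun p : Ω × ℕ => f (p.2 * δ) p.1 :=
    measurable_from_prod_countable_left fun k => by exact hf ((k : ℝ≥0) * δ)
  exact h1.comp (measurable_id.prodMk (h.measurable_gridIdx A N δ))

lemma IsBM.measurable_eval_incr (h : IsBM P X z) (t : ℝ≥0) :
    Measurable fun ω => (X ω t, incr t (X ω)) :=
  (h.measurable_eval t).prodMk ((measurable_incr t).comp h.meas)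

variable {Λ : Measure (ℝ≥0 → ℂ)} [IsProbabilityMeasure Λ]

lemma IsBM.map_grid (h : IsBM P X z) (hΛ : IsBMLaw Λ) (A : Set ℂ) (N : ℕ) (δ : ℝ≥0) :
    P.map (fun ω => (X ω (gridIdx A N δ (X ω) * δ), incr (gridIdx A N δ (X ω) * δ) (X ω))) =
      (P.map fun ω => X ω (gridIdx A N δ (X ω) * δ)).prod Λ := by
  have := h.prob
  have h1 := h.measurable_comp_gridIdx A N δ h.measurable_eval_incr
  have h2 := h.measurable_comp_gridIdx A N δ h.measurable_eval
  have hB := fun k => h.past_le _ _ (measurableSet_past_gridIdx X A N δ k)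
  conv_lhs => rw [h.eq_sum_restrict A N δ]
  conv_rhs => rw [h.eq_sum_restrict A N δ]
  rw [Measure.map_sum h1.aemeasurable, Measure.map_sum h2.aemeasurable, Measure.prod_sum_left]
  congr 1
  ext1 k
  rw [Measure.map_congr (g := fun ω => (X ω (k * δ), incr (k * δ) (X ω))),
    h.map_prod_incr hΛ (measurableSet_past_gridIdx X A N δ k)]
  · congr 1
    refine Measure.map_congr ?_
    filter_upwards [ae_restrict_mem (hB k)] with ω hω
    rw [show gridIdx A N δ (X ω) = k from hω]
  · filter_upwards [ae_restrict_mem (hB k)] with ω hω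
    rw [show gridIdx A N δ (X ω) = k from hω]

variable {A : Set ℂ}

lemma IsBM.tendsto_grid_eval (h : IsBM P X z) (hA : IsClosed A) (T : ℝ≥0) (ω : Ω) (u : ℝ≥0) :
    Tendsto (fun n : ℕ => X ω ((gridIdx A (n + 1) (T / (n + 1)) (X ω) : ℝ≥0) * (T / (n + 1)) + u))
      atTop (𝓝 (X ω (capTime A T (X ω) + u))) :=
  ((h.cont ω).tendsto _).comp ((tendsto_grid hA T (h.cont ω)).add_const u)

lemma IsBM.measurable_eval_capTime_add (h : IsBM P X z) (hA : IsClosed A) (T u : ℝ≥0) :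
    Measurable fun ω => X ω (capTime A T (X ω) + u) :=
  measurable_of_tendsto_metrizable
    (fun n : ℕ => h.measurable_comp_gridIdx A (n + 1) (T / (n + 1))
      (f := fun t ω => X ω (t + u)) fun t => h.measurable_eval (t + u))
    (tendsto_pi_nhds.2 fun ω => h.tendsto_grid_eval hA T ω u)

lemma IsBM.measurable_eval_capTime (h : IsBM P X z) (hA : IsClosed A) (T : ℝ≥0) :
    Measurable fun ω => X ω (capTime A T (X ω)) := by
  simpa using h.measurable_eval_capTime_add hA T 0

lemma IsBM.measurable_incr_capTime (h : IsBM P X z) (hA : IsClosed A) (T : ℝ≥0) :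
    Measurable fun ω => incr (capTime A T (X ω)) (X ω) :=
  measurable_pi_lambda _ fun u =>
    (h.measurable_eval_capTime_add hA T u).sub (h.measurable_eval_capTime hA T)

lemma IsBM.map_capTime_restrict (h : IsBM P X z) (hΛ : IsBMLaw Λ) (hA : IsClosed A) (T : ℝ≥0)
    (I : Finset ℝ≥0) :
    P.map (fun ω => (X ω (capTime A T (X ω)), I.restrict (incr (capTime A T (X ω)) (X ω)))) =
      (P.map fun ω => X ω (capTime A T (X ω))).prod (Λ.map (I.restrict : _ → (I → ℂ))) := by
  have := h.prob
  have hm1 := h.measurable_eval_capTime hA T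
  have hm2 : Measurable fun ω => I.restrict (incr (capTime A T (X ω)) (X ω)) :=
    (Finset.measurable_restrict (X := fun _ => ℂ) I).comp (h.measurable_incr_capTime hA T)
  refine Measure.eq_prod_of_integral_mul_boundedContinuousFunction fun f g => ?_
  have hfm : Measurable fun p : ℂ × (I → ℂ) => f p.1 * g p.2 := by fun_prop
  rw [integral_map (hm1.prodMk hm2).aemeasurable hfm.aestronglyMeasurable,
    integral_map hm1.aemeasurable f.continuous.aestronglyMeasurable]
  let τ : ℕ → Ω → ℝ≥0 := fun n ω => gridIdx A (n + 1) (T / (n + 1)) (X ω) * (T / (n + 1))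
  have hg2 : ∀ n, Measurable fun ω => (X ω (τ n ω), incr (τ n ω) (X ω)) := fun n =>
    h.measurable_comp_gridIdx A (n + 1) (T / (n + 1)) h.measurable_eval_incr
  have hfm2 : Measurable fun p : ℂ × (ℝ≥0 → ℂ) => f p.1 * g (I.restrict p.2) :=
    hfm.comp (measurable_fst.prodMk ((Finset.measurable_restrict I).comp measurable_snd))
  have heq : ∀ n, ∫ ω, f (X ω (τ n ω)) * g (I.restrict (incr (τ n ω) (X ω))) ∂P =
      (∫ ω, f (X ω (τ n ω)) ∂P) * ∫ t, g t ∂(Λ.map (I.restrict : _ → (I → ℂ))) := by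
    intro n
    have h1 := h.map_grid hΛ A (n + 1) (T / (n + 1))
    have h2 : ∫ ω, f (X ω (τ n ω)) * g (I.restrict (incr (τ n ω) (X ω))) ∂P =
        ∫ p, f p.1 * g (I.restrict p.2) ∂(P.map fun ω => (X ω (τ n ω), incr (τ n ω) (X ω))) := by
      rw [integral_map (hg2 n).aemeasurable hfm2.aestronglyMeasurable]
    rw [h2, h1, integral_prod_mul (f := f) (g := fun w : ℝ≥0 → ℂ => g (I.restrict w : I → ℂ)),
      integral_map (hg2 n).fst.aemeasurable f.continuous.aestronglyMeasurable,
      integral_map (Finset.measurable_restrict I).aemeasurable g.continuous.aestronglyMeasurable]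
  have lim1 : Tendsto (fun n => ∫ ω, f (X ω (τ n ω)) * g (I.restrict (incr (τ n ω) (X ω))) ∂P)
      atTop (𝓝 (∫ ω, f (X ω (capTime A T (X ω))) *
        g (I.restrict (incr (capTime A T (X ω)) (X ω))) ∂P)) := by
    refine tendsto_integral_of_dominated_convergence (fun _ => ‖f‖ * ‖g‖)
      (fun n => (hfm2.comp (hg2 n)).aestronglyMeasurable) (integrable_const _) (fun n => ?_) ?_
    · refine Eventually.of_forall fun ω => ?_
      rw [norm_mul]
      exact mul_le_mul (f.norm_coe_le_norm _) (g.norm_coe_le_norm _) (norm_nonneg _) (norm_nonneg _)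
    · refine Eventually.of_forall fun ω => ?_
      have h0 := h.tendsto_grid_eval hA T ω 0
      simp only [add_zero] at h0
      refine ((f.continuous.tendsto _).comp h0).mul ((g.continuous.tendsto _).comp ?_)
      refine tendsto_pi_nhds.2 fun u => ?_
      exact (h.tendsto_grid_eval hA T ω u).sub h0
  have lim2 : Tendsto (fun n => ∫ ω, f (X ω (τ n ω)) ∂P) atTop
      (𝓝 (∫ ω, f (X ω (capTime A T (X ω))) ∂P)) := by
    refine tendsto_integral_of_dominated_convergence (fun _ => ‖f‖)
      (fun n => (f.continuous.measurable.comp (hg2 n).fst).aestronglyMeasurable)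
      (integrable_const _) (fun n => Eventually.of_forall fun ω => f.norm_coe_le_norm _) ?_
    refine Eventually.of_forall fun ω => (f.continuous.tendsto _).comp ?_
    simpa using h.tendsto_grid_eval hA T ω 0
  simp only [heq] at lim1
  exact tendsto_nhds_unique lim1 (lim2.mul_const _)

/-- **Strong Markov property** at capped hitting times of closed sets. -/
lemma IsBM.map_capTime (h : IsBM P X z) (hΛ : IsBMLaw Λ) (hA : IsClosed A) (T : ℝ≥0) :
    P.map (fun ω => (X ω (capTime A T (X ω)), incr (capTime A T (X ω)) (X ω))) =
      (P.map fun ω => X ω (capTime A T (X ω))).prod Λ := by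
  have := h.prob
  have hm1 := h.measurable_eval_capTime hA T
  have hm2 := h.measurable_incr_capTime hA T
  symm
  refine Measure.prod_eq fun C S hC hS => ?_
  have key : (P.restrict ((fun ω => X ω (capTime A T (X ω))) ⁻¹' C)).map
      (fun ω => incr (capTime A T (X ω)) (X ω)) =
      P ((fun ω => X ω (capTime A T (X ω))) ⁻¹' C) • Λ := by
    have hfin := Λ.smul_finite (measure_ne_top P ((fun ω => X ω (capTime A T (X ω))) ⁻¹' C))
    refine IsProjectiveLimit.unique (P := fun I : Finset ℝ≥0 =>
      (P ((fun ω => X ω (capTime A T (X ω))) ⁻¹' C) • Λ).map I.restrict)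
      (fun I => ?_) (fun I => rfl)
    simp only
    rw [Measure.map_map (Finset.measurable_restrict I) hm2, Measure.map_smul]
    ext D hD
    have h1 := congrArg (fun m => m (C ×ˢ D)) (h.map_capTime_restrict hΛ hA T I)
    have hm3 : Measurable fun ω => I.restrict (incr (capTime A T (X ω)) (X ω)) :=
      (Finset.measurable_restrict (X := fun _ => ℂ) I).comp hm2
    rw [Measure.prod_prod, Measure.map_apply (hm1.prodMk hm3) (hC.prod hD),
      Measure.map_apply hm1 hC] at h1
    rw [show (I.restrict ∘ fun ω => incr (capTime A T (X ω)) (X ω)) =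
      fun ω => I.restrict (incr (capTime A T (X ω)) (X ω)) from rfl,
      Measure.map_apply hm3 hD, Measure.restrict_apply (hm3 hD), Measure.smul_apply,
      smul_eq_mul, ← h1]
    congr 1
    ext ω
    simp [and_comm]
  have h2 := congrArg (fun m => m S) key
  simp only [Measure.smul_apply, smul_eq_mul] at h2
  rw [Measure.map_apply hm2 hS, Measure.restrict_apply (hm2 hS)] at h2
  rw [Measure.map_apply (hm1.prodMk hm2) (hC.prod hS), Measure.map_apply hm1 hC, ← h2]
  congr 1
  ext ω
  simp [and_comm]

lemma IsBM.integral_shift_capTime (h : IsBM P X z) (hΛ : IsBMLaw Λ) (hA : IsClosed A) (T : ℝ≥0)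
    {G : (ℝ≥0 → ℂ) → ℝ} {M : ℝ} (hG : Measurable G) (h0 : ∀ w, 0 ≤ G w) (hM : ∀ w, G w ≤ M) :
    ∫ ω, G (fun u => X ω (capTime A T (X ω) + u)) ∂P =
      ∫ ω, avg Λ G (X ω (capTime A T (X ω))) ∂P := by
  have := h.prob
  have hm := (h.measurable_eval_capTime hA T).prodMk (h.measurable_incr_capTime hA T)
  have hGt : Measurable fun p : ℂ × (ℝ≥0 → ℂ) => G (fun u => p.1 + p.2 u) :=
    hG.comp measurable_translate
  have h1 : ∫ ω, G (fun u => X ω (capTime A T (X ω) + u)) ∂P =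
      ∫ p, G (fun u => p.1 + p.2 u) ∂(P.map
        fun ω => (X ω (capTime A T (X ω)), incr (capTime A T (X ω)) (X ω))) := by
    rw [integral_map hm.aemeasurable hGt.aestronglyMeasurable]
    simp [incr]
  rw [h1, h.map_capTime hΛ hA T, integral_prod _ (Integrable.of_bound hGt.aestronglyMeasurable M
    (Eventually.of_forall fun w => by rw [Real.norm_of_nonneg (h0 _)]; exact hM _)),
    integral_map (h.measurable_eval_capTime hA T).aemeasurable]
  · rfl
  · exact (measurable_avg hG).aestronglyMeasurable

end

/-! ### Optional stopping -/

lemma integral_tendsto_of_sq_bound {Ω : Type*} [MeasurableSpace Ω] {P : Measure Ω}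
    [IsProbabilityMeasure P] {f : ℕ → Ω → ℂ} {g : Ω → ℂ} (hf : ∀ n, Measurable (f n))
    (hg : Measurable g) (hfg : ∀ ω, Tendsto (fun n => f n ω) atTop (𝓝 (g ω))) {K : ℝ≥0}
    (hK : ∀ n, ∫⁻ ω, ‖f n ω‖ₑ ^ 2 ∂P ≤ K) :
    Integrable g P ∧ Tendsto (fun n => ∫ ω, f n ω ∂P) atTop (𝓝 (∫ ω, g ω ∂P)) := by
  have hf_int : ∀ n, Integrable (f n) P := fun n => by
    refine (memLp_one_iff_integrable).1 (MemLp.mono_exponent (q := 2) ⟨(hf n).aestronglyMeasurable, ?_⟩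
      one_le_two)
    rw [eLpNorm_lt_top_iff_lintegral_rpow_enorm_lt_top (by simp) (by simp)]
    simpa using (hK n).trans_lt ENNReal.coe_lt_top
  have hgint : Integrable g P := by
    refine (memLp_one_iff_integrable).1 (MemLp.mono_exponent (q := 2) ⟨hg.aestronglyMeasurable, ?_⟩
      one_le_two)
    rw [eLpNorm_lt_top_iff_lintegral_rpow_enorm_lt_top (by simp) (by simp)]
    have h1 : ∫⁻ ω, liminf (fun n => ‖f n ω‖ₑ ^ 2) atTop ∂P ≤ K :=
      (lintegral_liminf_le fun n => (hf n).enorm.pow_const 2).trans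
        (liminf_le_of_le (by isBoundedDefault) fun b hb => by
          obtain ⟨n, hn⟩ := hb.exists
          exact hn.trans (hK n))
    have h2 : ∀ ω, liminf (fun n => ‖f n ω‖ₑ ^ 2) atTop = ‖g ω‖ₑ ^ 2 := fun ω =>
      (((ENNReal.continuous_pow 2).tendsto _).comp
        ((continuous_enorm.tendsto _).comp (hfg ω))).liminf_eq
    simp only [h2] at h1
    simpa using h1.trans_lt ENNReal.coe_lt_top
  refine ⟨hgint, ?_⟩
  have hui : UnifIntegrable f 1 P := by
    refine unifIntegrable_of le_rfl (by simp) (fun n => (hf n).aestronglyMeasurable) fun ε hε => ?_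
    refine ⟨(K + 1) / ε.toNNReal, fun n => ?_⟩
    set C : ℝ≥0 := (K + 1) / ε.toNNReal with hC
    have hε' : (ε.toNNReal : ℝ≥0) ≠ 0 := (Real.toNNReal_pos.2 hε).ne'
    have hC0 : C ≠ 0 := div_ne_zero (by positivity) hε'
    rw [eLpNorm_one_eq_lintegral_enorm]
    calc ∫⁻ ω, ‖({x | C ≤ ‖f n x‖₊}.indicator (f n)) ω‖ₑ ∂P
        ≤ ∫⁻ ω, (C : ℝ≥0∞)⁻¹ * ‖f n ω‖ₑ ^ 2 ∂P := by
          refine lintegral_mono fun ω => ?_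
          by_cases hω : C ≤ ‖f n ω‖₊
          · rw [Set.indicator_of_mem (by exact hω)]
            have hC' : (C : ℝ≥0∞) ≤ ‖f n ω‖ₑ := by
              rw [enorm_eq_nnnorm]
              exact_mod_cast hω
            rw [pow_two, ← mul_assoc]
            calc ‖f n ω‖ₑ = (C : ℝ≥0∞)⁻¹ * C * ‖f n ω‖ₑ := by
                  rw [ENNReal.inv_mul_cancel (by simpa using hC0) (by simp), one_mul]
              _ ≤ _ := by gcongr
          · rw [Set.indicator_of_notMem (by exact hω)]
            simp
      _ = (C : ℝ≥0∞)⁻¹ * ∫⁻ ω, ‖f n ω‖ₑ ^ 2 ∂P :=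
          lintegral_const_mul _ ((hf n).enorm.pow_const 2)
      _ ≤ (C : ℝ≥0∞)⁻¹ * K := by gcongr; exact hK n
      _ ≤ ENNReal.ofReal ε := by
          rw [← ENNReal.coe_inv hC0, ← ENNReal.coe_mul, ENNReal.ofReal, ENNReal.coe_le_coe, hC,
            inv_div, div_mul_eq_mul_div, div_le_iff₀ (by positivity)]
          gcongr
          exact le_self_add
  have h3 := tendsto_Lp_finite_of_tendsto_ae le_rfl (by simp)
    (fun n => (hf n).aestronglyMeasurable) (memLp_one_iff_integrable.2 hgint) hui
    (Eventually.of_forall hfg)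
  exact tendsto_integral_of_L1' g hg.aestronglyMeasurable (Eventually.of_forall hf_int) h3

/-- Continuous functions with square-integrable Gaussian averages and the mean value property
with respect to the increments of planar Brownian motion. -/
structure GaussMean (u : ℂ → ℂ) : Prop where
  cont : Continuous u
  memLp : ∀ x v, MemLp (fun w => u (x + w)) 2 (gam v)
  mean : ∀ x v, ∫ w, u (x + w) ∂gam v = u x

section
variable {Ω : Type*} [MeasurableSpace Ω] {P : Measure Ω} {X : Ω → ℝ≥0 → ℂ} {z : ℂ}

lemma IsBM.map_pair (h : IsBM P X z) {s t : ℝ≥0} (hst : s ≤ t) {B : Set Ω}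
    (hB : MeasurableSet[past X s] B) :
    (P.restrict B).map (fun ω => (X ω s, X ω t - X ω s)) =
      ((P.restrict B).map fun ω => X ω s).prod (gam (t - s)) := by
  have := h.prob
  have hm := (h.measurable_eval t).sub (h.measurable_eval s)
  have hm2 : Measurable fun ω => (X ω s, X ω t - X ω s) := (h.measurable_eval s).prodMk hm
  symm
  refine Measure.prod_eq fun C D hC hD => ?_
  rw [Measure.map_apply hm2 (hC.prod hD), Measure.map_apply (h.measurable_eval s) hC,
    Measure.restrict_apply (hm2 (hC.prod hD)), Measure.restrict_apply (h.measurable_eval s hC),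
    ← h.measure_inter hst ((measurable_past X le_rfl hC).inter hB) hD]
  congr 1
  ext ω
  simp [Set.mem_inter_iff]
  tauto

lemma IsBM.map_eval (h : IsBM P X z) (t : ℝ≥0) :
    P.map (fun ω => X ω t) = (gam t).map fun w => z + w := by
  have := h.prob
  have h1 : P.map (fun ω => X ω t - z) = gam t := by
    ext C hC
    have h2 := h.measure_inter (zero_le (a := t)) (@MeasurableSet.univ _ (past X 0)) hC
    rw [Measure.map_apply ((h.measurable_eval t).sub_const z) hC]
    simp only [h.start, Set.univ_inter, tsub_zero, measure_univ, one_mul] at h2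
    exact h2
  rw [← h1, Measure.map_map (measurable_const_add z) ((h.measurable_eval t).sub_const z)]
  congr 1
  ext ω
  simp

variable {u : ℂ → ℂ}

lemma GaussMean.measurable (hu : GaussMean u) : Measurable u := hu.cont.measurable

lemma IsBM.memLp_eval (h : IsBM P X z) (hu : GaussMean u) (t : ℝ≥0) :
    MemLp (fun ω => u (X ω t)) 2 P := by
  have h1 : MemLp u 2 (P.map fun ω => X ω t) := by
    rw [h.map_eval t]
    exact (memLp_map_measure_iff hu.cont.aestronglyMeasurable
      (measurable_const_add z).aemeasurable).2 (hu.memLp z t)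
  exact (memLp_map_measure_iff hu.cont.aestronglyMeasurable
    (h.measurable_eval t).aemeasurable).1 h1

lemma IsBM.setIntegral_eq (h : IsBM P X z) (hu : GaussMean u) {s t : ℝ≥0} (hst : s ≤ t)
    {B : Set Ω} (hB : MeasurableSet[past X s] B) :
    ∫ ω in B, u (X ω t) ∂P = ∫ ω in B, u (X ω s) ∂P := by
  have := h.prob
  have hm2 : Measurable fun ω => (X ω s, X ω t - X ω s) :=
    (h.measurable_eval s).prodMk ((h.measurable_eval t).sub (h.measurable_eval s))
  have hu2 : Measurable fun p : ℂ × ℂ => u (p.1 + p.2) :=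
    hu.measurable.comp (measurable_fst.add measurable_snd)
  have h1 : ∫ ω in B, u (X ω t) ∂P =
      ∫ p, u (p.1 + p.2) ∂((P.restrict B).map fun ω => (X ω s, X ω t - X ω s)) := by
    rw [integral_map hm2.aemeasurable hu2.aestronglyMeasurable]
    simp
  have hi : Integrable (fun p : ℂ × ℂ => u (p.1 + p.2))
      ((P.restrict B).map fun ω => (X ω s, X ω t - X ω s)) := by
    rw [integrable_map_measure hu2.aestronglyMeasurable hm2.aemeasurable]
    refine Integrable.congr (((h.memLp_eval hu t).integrable one_le_two).integrableOn (s := B)) ?_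
    exact Eventually.of_forall fun ω => by simp
  rw [h.map_pair hst hB] at hi h1
  rw [h1, integral_prod _ hi]
  simp only [hu.mean]
  rw [integral_map (h.measurable_eval s).aemeasurable hu.cont.aestronglyMeasurable]

lemma GaussMean.enorm_sq_le (hu : GaussMean u) (x : ℂ) (v : ℝ≥0) :
    ‖u x‖ₑ ^ 2 ≤ ∫⁻ w, ‖u (x + w)‖ₑ ^ 2 ∂gam v := by
  have h1 : ‖u x‖ₑ ≤ eLpNorm (fun w => u (x + w)) 2 (gam v) := by
    calc ‖u x‖ₑ = ‖∫ w, u (x + w) ∂gam v‖ₑ := by rw [hu.mean]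
      _ ≤ eLpNorm (fun w => u (x + w)) 1 (gam v) := by
        rw [eLpNorm_one_eq_lintegral_enorm]
        exact enorm_integral_le_lintegral_enorm _
      _ ≤ _ := eLpNorm_le_eLpNorm_of_exponent_le one_le_two (hu.memLp x v).1
  calc ‖u x‖ₑ ^ 2 ≤ eLpNorm (fun w => u (x + w)) 2 (gam v) ^ 2 := by gcongr
    _ = _ := by
      have := eLpNorm_nnreal_pow_eq_lintegral (p := 2) (f := fun w => u (x + w)) (μ := gam v)
        (by simp)
      simpa using this

lemma IsBM.setLIntegral_sq_le (h : IsBM P X z) (hu : GaussMean u) {s t : ℝ≥0} (hst : s ≤ t)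
    {B : Set Ω} (hB : MeasurableSet[past X s] B) :
    ∫⁻ ω in B, ‖u (X ω s)‖ₑ ^ 2 ∂P ≤ ∫⁻ ω in B, ‖u (X ω t)‖ₑ ^ 2 ∂P := by
  have := h.prob
  have hm2 : Measurable fun ω => (X ω s, X ω t - X ω s) :=
    (h.measurable_eval s).prodMk ((h.measurable_eval t).sub (h.measurable_eval s))
  have hu2 : Measurable fun p : ℂ × ℂ => ‖u (p.1 + p.2)‖ₑ ^ 2 :=
    (hu.measurable.comp (measurable_fst.add measurable_snd)).enorm.pow_const 2
  have h1 : ∫⁻ ω in B, ‖u (X ω t)‖ₑ ^ 2 ∂P =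
      ∫⁻ p, ‖u (p.1 + p.2)‖ₑ ^ 2 ∂((P.restrict B).map fun ω => (X ω s, X ω t - X ω s)) := by
    rw [lintegral_map hu2 hm2]
    simp
  rw [h1, h.map_pair hst hB, lintegral_prod _ hu2.aemeasurable,
    ← lintegral_map (f := fun x => ‖u x‖ₑ ^ 2) (hu.measurable.enorm.pow_const 2)
      (h.measurable_eval s)]
  exact lintegral_mono fun x => hu.enorm_sq_le x _

lemma IsBM.lintegral_grid_sq_le (h : IsBM P X z) (hu : GaussMean u) (A : Set ℂ) (N : ℕ)
    (δ : ℝ≥0) : ∫⁻ ω, ‖u (X ω (gridIdx A N δ (X ω) * δ))‖ₑ ^ 2 ∂P ≤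
      ∫⁻ ω, ‖u (X ω (N * δ))‖ₑ ^ 2 ∂P := by
  rw [h.eq_sum_restrict A N δ, lintegral_sum_measure, lintegral_sum_measure]
  refine ENNReal.tsum_le_tsum fun k => ?_
  have hB := measurableSet_past_gridIdx X A N δ k
  rw [setLIntegral_congr_fun (g := fun ω => ‖u (X ω (k * δ))‖ₑ ^ 2) (h.past_le _ _ hB)
    fun ω hω => by simp only [show gridIdx A N δ (X ω) = k from hω]]
  by_cases hk : k ≤ N
  · exact h.setLIntegral_sq_le hu (by gcongr) hB
  · have : {ω | gridIdx A N δ (X ω) = k} = ∅ := by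
      refine Set.eq_empty_of_forall_notMem fun ω hω => hk ?_
      exact (show gridIdx A N δ (X ω) = k from hω) ▸ gridIdx_le A N δ (X ω)
    simp [this]

lemma IsBM.integral_grid (h : IsBM P X z) (hu : GaussMean u) (A : Set ℂ) (N : ℕ) (δ : ℝ≥0)
    (hi : Integrable (fun ω => u (X ω (gridIdx A N δ (X ω) * δ))) P) :
    ∫ ω, u (X ω (gridIdx A N δ (X ω) * δ)) ∂P = u z := by
  have := h.prob
  have h0 : ∫ ω, u (X ω (N * δ)) ∂P = u z := by
    have := h.setIntegral_eq hu (zero_le (a := N * δ)) (@MeasurableSet.univ _ (past X 0))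
    simpa [h.start] using this
  have hi2 := (h.memLp_eval hu (N * δ)).integrable one_le_two
  rw [← h0]
  rw [h.eq_sum_restrict A N δ] at hi hi2 ⊢
  rw [integral_sum_measure hi, integral_sum_measure hi2]
  congr 1
  ext1 k
  have hB := measurableSet_past_gridIdx X A N δ k
  rw [setIntegral_congr_fun (g := fun ω => u (X ω (k * δ))) (h.past_le _ _ hB)
    fun ω hω => by simp only [show gridIdx A N δ (X ω) = k from hω]]
  by_cases hk : k ≤ N
  · exact (h.setIntegral_eq hu (by gcongr) hB).symm
  · have : {ω | gridIdx A N δ (X ω) = k} = ∅ := by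
      refine Set.eq_empty_of_forall_notMem fun ω hω => hk ?_
      exact (show gridIdx A N δ (X ω) = k from hω) ▸ gridIdx_le A N δ (X ω)
    simp [this]

/-- **Optional stopping** at capped hitting times of closed sets. -/
lemma IsBM.integral_capTime (h : IsBM P X z) (hu : GaussMean u) {A : Set ℂ} (hA : IsClosed A)
    (T : ℝ≥0) : Integrable (fun ω => u (X ω (capTime A T (X ω)))) P ∧
      ∫ ω, u (X ω (capTime A T (X ω))) ∂P = u z := by
  have := h.prob
  have hT : ∀ n : ℕ, ((n + 1 : ℕ) : ℝ≥0) * (T / (n + 1)) = T := fun n => by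
    push_cast
    exact mul_div_cancel₀ T (by positivity)
  have hlt : ∫⁻ ω, ‖u (X ω T)‖ₑ ^ 2 ∂P < ∞ := by
    have := (eLpNorm_lt_top_iff_lintegral_rpow_enorm_lt_top (by simp) (by simp)).1
      (h.memLp_eval hu T).2
    simpa using this
  have hf : ∀ n : ℕ, Measurable fun ω =>
      u (X ω (gridIdx A (n + 1) (T / (n + 1)) (X ω) * (T / (n + 1)))) := fun n =>
    hu.measurable.comp (h.measurable_comp_gridIdx A (n + 1) (T / (n + 1)) h.measurable_eval)
  have hK : ∀ n : ℕ, ∫⁻ ω, ‖u (X ω (gridIdx A (n + 1) (T / (n + 1)) (X ω) * (T / (n + 1))))‖ₑ ^ 2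
      ∂P ≤ (∫⁻ ω, ‖u (X ω T)‖ₑ ^ 2 ∂P).toNNReal := fun n => by
    have := h.lintegral_grid_sq_le hu A (n + 1) (T / (n + 1))
    rw [hT n] at this
    rwa [ENNReal.coe_toNNReal hlt.ne]
  obtain ⟨h1, h2⟩ := integral_tendsto_of_sq_bound hf
    (hu.measurable.comp (h.measurable_eval_capTime hA T))
    (fun ω => (hu.cont.tendsto _).comp (by simpa using h.tendsto_grid_eval hA T ω 0)) hK
  refine ⟨h1, tendsto_nhds_unique h2 ?_⟩
  refine tendsto_const_nhds.congr fun n => (h.integral_grid hu A (n + 1) (T / (n + 1)) ?_).symm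
  refine memLp_one_iff_integrable.1 (MemLp.mono_exponent (q := 2)
    ⟨(hf n).aestronglyMeasurable, ?_⟩ one_le_two)
  rw [eLpNorm_lt_top_iff_lintegral_rpow_enorm_lt_top (by simp) (by simp)]
  simpa using (hK n).trans_lt ENNReal.coe_lt_top

end

lemma equivRealProd_symm_eq (p : ℝ × ℝ) :
    Complex.equivRealProd.symm p = (p.1 : ℂ) + p.2 * Complex.I := by
  simp [Complex.equivRealProd_symm_apply]

lemma memLp_gam_iff {f : ℂ → ℂ} (hf : Continuous f) (v : ℝ≥0) (p : ℝ≥0∞) :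
    MemLp f p (gam v) ↔ MemLp (fun q : ℝ × ℝ => f ((q.1 : ℂ) + q.2 * Complex.I)) p
      ((ProbabilityTheory.gaussianReal 0 v).prod (ProbabilityTheory.gaussianReal 0 v)) := by
  rw [gam, memLp_map_measure_iff hf.aestronglyMeasurable measurable_equivRealProd_symm.aemeasurable]
  simp only [Function.comp_def, equivRealProd_symm_eq]

lemma integral_gam {f : ℂ → ℂ} (hf : Continuous f) (v : ℝ≥0) :
    ∫ w, f w ∂gam v = ∫ q : ℝ × ℝ, f ((q.1 : ℂ) + q.2 * Complex.I)
      ∂((ProbabilityTheory.gaussianReal 0 v).prod (ProbabilityTheory.gaussianReal 0 v)) := by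
  rw [gam, integral_map measurable_equivRealProd_symm.aemeasurable hf.aestronglyMeasurable]
  simp only [equivRealProd_symm_eq]

lemma gaussMean_id : GaussMean fun z => z where
  cont := continuous_id
  memLp x v := by
    rw [memLp_gam_iff (by fun_prop)]
    have h0 := ProbabilityTheory.memLp_id_gaussianReal' (μ := 0) (v := v) 2 (by simp)
    have h1 := (h0.comp_measurePreserving (measurePreserving_fst
      (μ := ProbabilityTheory.gaussianReal 0 v) (ν := ProbabilityTheory.gaussianReal 0 v))).ofReal
      (K := ℂ)
    have h2 := (h0.comp_measurePreserving (measurePreserving_snd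
      (μ := ProbabilityTheory.gaussianReal 0 v) (ν := ProbabilityTheory.gaussianReal 0 v))).ofReal
      (K := ℂ)
    exact (memLp_const x).add (h1.add (h2.mul_const Complex.I))
  mean x v := by
    rw [integral_gam (by fun_prop)]
    have hi : Integrable (fun a : ℝ => a) (ProbabilityTheory.gaussianReal 0 v) :=
      (ProbabilityTheory.memLp_id_gaussianReal' (μ := 0) (v := v) 1 (by simp)).integrable le_rfl
    have h1 : Integrable (fun q : ℝ × ℝ => (q.1 : ℂ))
        ((ProbabilityTheory.gaussianReal 0 v).prod (ProbabilityTheory.gaussianReal 0 v)) :=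
      (hi.comp_fst (ProbabilityTheory.gaussianReal 0 v)).ofReal (𝕜 := ℂ)
    have h2 : Integrable (fun q : ℝ × ℝ => (q.2 : ℂ))
        ((ProbabilityTheory.gaussianReal 0 v).prod (ProbabilityTheory.gaussianReal 0 v)) :=
      (hi.comp_snd (ProbabilityTheory.gaussianReal 0 v)).ofReal (𝕜 := ℂ)
    have e1 := integral_fun_fst (μ := ProbabilityTheory.gaussianReal 0 v)
      (ν := ProbabilityTheory.gaussianReal 0 v) (fun a : ℝ => (a : ℂ))
    have e2 := integral_fun_snd (μ := ProbabilityTheory.gaussianReal 0 v)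
      (ν := ProbabilityTheory.gaussianReal 0 v) (fun a : ℝ => (a : ℂ))
    have e0 : ∫ a : ℝ, (a : ℂ) ∂ProbabilityTheory.gaussianReal 0 v = 0 := by
      rw [integral_complex_ofReal, ProbabilityTheory.integral_id_gaussianReal]
      simp
    rw [e0] at e1 e2
    have h3 : Integrable (fun q : ℝ × ℝ => (q.2 : ℂ) * Complex.I)
      ((ProbabilityTheory.gaussianReal 0 v).prod (ProbabilityTheory.gaussianReal 0 v)) :=
      h2.mul_const Complex.I
    have h4 : Integrable (fun q : ℝ × ℝ => (q.1 : ℂ) + q.2 * Complex.I)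
      ((ProbabilityTheory.gaussianReal 0 v).prod (ProbabilityTheory.gaussianReal 0 v)) := h1.add h3
    rw [integral_add (integrable_const x) h4, integral_add h1 h3, integral_mul_const, e1, e2]
    simp

lemma gaussMean_exp (θ M : ℝ) :
    GaussMean fun z => Complex.exp (Complex.I * θ * (z - Complex.I * M)) where
  cont := by fun_prop
  memLp x v := by
    rw [memLp_gam_iff (by fun_prop), memLp_two_iff_integrable_sq_norm (by fun_prop)]
    have h1 := (ProbabilityTheory.integrable_exp_mul_gaussianReal (μ := 0) (v := v)
      (-2 * θ)).comp_snd (ProbabilityTheory.gaussianReal 0 v)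
    refine (h1.const_mul (Real.exp (-2 * θ * (x.im - M)))).congr (Eventually.of_forall fun q => ?_)
    simp only [Complex.norm_exp]
    rw [← Real.exp_add, ← Real.exp_nat_mul]
    congr 1
    simp
    ring
  mean x v := by
    rw [integral_gam (by fun_prop)]
    have h1 : ∀ q : ℝ × ℝ, Complex.exp (Complex.I * θ *
        (x + ((q.1 : ℂ) + q.2 * Complex.I) - Complex.I * M)) =
        Complex.exp (Complex.I * θ * (x - Complex.I * M)) *
          (Complex.exp ((θ * Complex.I) * (id q.1 : ℝ)) *
            Complex.exp (((-θ : ℝ) : ℂ) * (id q.2 : ℝ))) := fun q => by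
      rw [← Complex.exp_add, ← Complex.exp_add]
      congr 1
      push_cast
      simp only [id]
      linear_combination (θ * q.2 : ℂ) * Complex.I_sq
    simp only [h1]
    rw [integral_const_mul, integral_prod_mul (fun a : ℝ => Complex.exp (θ * Complex.I * (id a : ℝ)))
      (fun a : ℝ => Complex.exp (((-θ : ℝ) : ℂ) * (id a : ℝ)))]
    have e1 := ProbabilityTheory.complexMGF_id_gaussianReal (μ := 0) (v := v) (θ * Complex.I)
    have e2 := ProbabilityTheory.complexMGF_id_gaussianReal (μ := 0) (v := v) ((-θ : ℝ) : ℂ)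
    rw [ProbabilityTheory.complexMGF] at e1 e2
    rw [e1, e2, ← Complex.exp_add, ← Complex.exp_add]
    congr 1
    push_cast
    linear_combination (v * θ ^ 2 / 2 : ℂ) * Complex.I_sq

/-! ### The expected height at the hitting time -/

lemma le_im_capTime {A : Set ℂ} {M : ℝ} (h0 : {z : ℂ | z.im ≤ M} ⊆ A) {w : ℝ≥0 → ℂ}
    (hw : Continuous w) (hz : M ≤ (w 0).im) (T : ℝ≥0) : M ≤ (w (capTime A T w)).im := by
  by_contra! hlt
  have hne : capTime A T w ≠ 0 := fun h => by
    rw [h] at hlt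
    exact absurd hz (not_le.2 hlt)
  have hcl : capTime A T w ∈ closure (Set.Iio (capTime A T w)) := by
    rw [closure_Iio' ⟨0, pos_iff_ne_zero.2 hne⟩]
    exact Set.mem_Iic.2 le_rfl
  have hopen : IsOpen {r | (w r).im < M} :=
    isOpen_lt (Complex.continuous_im.comp hw) continuous_const
  obtain ⟨r, hr1, hr2⟩ := mem_closure_iff.1 hcl _ hopen hlt
  exact notMem_of_lt_capTime hr2 (h0 (show (w r).im ≤ M from le_of_lt hr1))

/-- The event that the set `A` is hit up to time `t`. -/
def hitSet {Ω : Type*} (A : Set ℂ) (X : Ω → ℝ≥0 → ℂ) (t : ℝ≥0) : Set Ω :=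
  {ω | ∃ r ≤ t, X ω r ∈ A}

lemma im_nonneg_of_notMem_hitSet {Ω : Type*} {A : Set ℂ} {X : Ω → ℝ≥0 → ℂ}
    (h0 : {z : ℂ | z.im ≤ 0} ⊆ A) {t : ℝ≥0} {ω : Ω}
    (hω : ω ∈ (hitSet A X t)ᶜ) : 0 ≤ (X ω t).im := by
  by_contra! hlt
  exact hω ⟨t, le_rfl, h0 (show (X ω t).im ≤ 0 from hlt.le)⟩

/-- The mean height at which Brownian motion with increment law `Λ`, started at `x`, hits `A`. -/
noncomputable def height (Λ : Measure (ℝ≥0 → ℂ)) (A : Set ℂ) (M : ℝ) : ℂ → ℝ :=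
  avg Λ (pathVal A M)

section
variable {Ω : Type*} [MeasurableSpace Ω] {P : Measure Ω} {X : Ω → ℝ≥0 → ℂ} {z : ℂ}

lemma IsBM.measurableSet_hitSet_past (h : IsBM P X z) {A : Set ℂ} (hA : IsClosed A) (t : ℝ≥0) :
    MeasurableSet[past X t] (hitSet A X t) := by
  have h1 := @measurableSet_hitBy Ω (past X t) A (fun u ω => X ω u) t
    fun _ hu => measurable_past X hu
  have h2 : {ω | HitBy A (fun u => X ω u) t} = hitSet A X t := by
    ext ω
    exact hitBy_iff hA (h.cont ω)
  rwa [h2] at h1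

lemma IsBM.measurableSet_hitSet (h : IsBM P X z) {A : Set ℂ} (hA : IsClosed A) (t : ℝ≥0) :
    MeasurableSet (hitSet A X t) := h.past_le t _ (h.measurableSet_hitSet_past hA t)

variable {A : Set ℂ} {M : ℝ}

lemma IsBM.integrable_pathVal (h : IsBM P X z) (A : Set ℂ) (hM : 0 ≤ M) :
    Integrable (fun ω => pathVal A M (X ω)) P := by
  have := h.prob
  refine Integrable.of_bound ((measurable_pathVal A M).comp h.meas).aestronglyMeasurable M
    (Eventually.of_forall fun ω => ?_)
  rw [Real.norm_of_nonneg (pathVal_nonneg _ _ _)]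
  exact pathVal_le A hM _

lemma IsBM.integrable_im (h : IsBM P X z) (t : ℝ≥0) : Integrable (fun ω => (X ω t).im) P := by
  have := h.prob
  exact ((h.memLp_eval gaussMean_id t).integrable one_le_two).im

lemma IsBM.integral_hitSet_add (h : IsBM P X z) (hA : IsClosed A)
    (h0 : {z : ℂ | z.im ≤ 0} ⊆ A) (hM : 0 ≤ M) (hAM : ∀ z ∈ A, z.im ≤ M) (hz : 0 ≤ z.im)
    (t : ℝ≥0) :
    ∫ ω in hitSet A X t, pathVal A M (X ω) ∂P + ∫ ω in (hitSet A X t)ᶜ, (X ω t).im ∂P = z.im := by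
  obtain ⟨hi, he⟩ := h.integral_capTime gaussMean_id hA t
  have he2 : ∫ ω, (X ω (capTime A t (X ω))).im ∂P = z.im := by
    rw [← he]
    exact integral_im hi
  have hB := h.measurableSet_hitSet hA t
  have hi' : Integrable (fun ω => (X ω (capTime A t (X ω))).im) P := hi.im
  rw [← he2, ← integral_add_compl hB hi']
  congr 1
  · refine setIntegral_congr_fun hB fun ω hω => ?_
    have h1 := le_im_capTime h0 (h.cont ω) (by rwa [h.start]) t
    simp only [pathVal_eq hA hM hAM (h.cont ω), hitVal_eq_capTime hω, max_eq_left h1]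
  · refine setIntegral_congr_fun hB.compl fun ω hω => ?_
    have h1 : capTime A t (X ω) = t := capTime_eq_of_not_hit fun r hr hrA => hω ⟨r, hr, hrA⟩
    simp only [h1]

variable {Λ : Measure (ℝ≥0 → ℂ)} [IsProbabilityMeasure Λ]

lemma measurable_height (Λ : Measure (ℝ≥0 → ℂ)) [IsProbabilityMeasure Λ] (A : Set ℂ) (M : ℝ) :
    Measurable (height Λ A M) := measurable_avg (measurable_pathVal A M)

lemma height_nonneg (Λ : Measure (ℝ≥0 → ℂ)) (A : Set ℂ) (M : ℝ) (x : ℂ) : 0 ≤ height Λ A M x :=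
  avg_nonneg (pathVal_nonneg A M) x

lemma height_le (Λ : Measure (ℝ≥0 → ℂ)) [IsProbabilityMeasure Λ] (A : Set ℂ) (hM : 0 ≤ M)
    (x : ℂ) : height Λ A M x ≤ M :=
  avg_le (measurable_pathVal A M) (pathVal_nonneg A M) (pathVal_le A hM) x

lemma IsBM.integral_pathVal (h : IsBM P X z) (hΛ : IsBMLaw Λ) (A : Set ℂ) (hM : 0 ≤ M) :
    ∫ ω, pathVal A M (X ω) ∂P = height Λ A M z :=
  h.integral_eq_avg hΛ (measurable_pathVal A M) (pathVal_nonneg A M) (pathVal_le A hM)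

lemma IsBM.integrable_height (h : IsBM P X z) (A : Set ℂ) (hM : 0 ≤ M) {f : Ω → ℂ}
    (hf : Measurable f) : Integrable (fun ω => height Λ A M (f ω)) P := by
  have := h.prob
  refine Integrable.of_bound ((measurable_height Λ A M).comp hf).aestronglyMeasurable M
    (Eventually.of_forall fun ω => ?_)
  rw [Real.norm_of_nonneg (height_nonneg _ _ _ _)]
  exact height_le Λ A hM _

lemma IsBM.height_eq_sub (h : IsBM P X z) (hΛ : IsBMLaw Λ) (hA : IsClosed A)
    (h0 : {z : ℂ | z.im ≤ 0} ⊆ A) (hM : 0 ≤ M) (hAM : ∀ z ∈ A, z.im ≤ M) (hz : 0 ≤ z.im)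
    (t : ℝ≥0) :
    height Λ A M z = z.im - ∫ ω in (hitSet A X t)ᶜ, ((X ω t).im - height Λ A M (X ω t)) ∂P := by
  have hB := h.measurableSet_hitSet hA t
  have h1 := h.integral_hitSet_add hA h0 hM hAM hz t
  have h2 : ∫ ω in (hitSet A X t)ᶜ, pathVal A M (X ω) ∂P =
      ∫ ω in (hitSet A X t)ᶜ, height Λ A M (X ω t) ∂P := by
    rw [height, ← h.setIntegral_shift hΛ (measurable_pathVal A M) (pathVal_nonneg A M)
      (pathVal_le A hM) (h.measurableSet_hitSet_past hA t).compl]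
    refine setIntegral_congr_fun hB.compl fun ω hω => ?_
    have hc : Continuous fun u => X ω (t + u) := (h.cont ω).comp (continuous_const_add t)
    simp only [pathVal_eq hA hM hAM (h.cont ω), pathVal_eq hA hM hAM hc]
    exact (hitVal_shift fun r hr hrA => hω ⟨r, hr.le, hrA⟩).symm
  rw [integral_sub (h.integrable_im t).integrableOn
    (h.integrable_height A hM (h.measurable_eval t)).integrableOn, ← h2,
    ← h.integral_pathVal hΛ A hM, ← integral_add_compl hB (h.integrable_pathVal A hM)]
  linarith

lemma IsBM.tendsto_setIntegral_hitSet (h : IsBM P X z) (hΛ : IsBMLaw Λ) (hA : IsClosed A)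
    (hM : 0 ≤ M) (hAM : ∀ z ∈ A, z.im ≤ M) :
    Tendsto (fun n : ℕ => ∫ ω in hitSet A X n, pathVal A M (X ω) ∂P) atTop
      (𝓝 (height Λ A M z)) := by
  rw [← h.integral_pathVal hΛ A hM]
  have hB := fun n : ℕ => h.measurableSet_hitSet hA (n : ℝ≥0)
  simp only [← integral_indicator (hB _)]
  refine tendsto_integral_of_dominated_convergence (fun ω => pathVal A M (X ω))
    (fun n => ((h.integrable_pathVal A hM).indicator (hB n)).aestronglyMeasurable)
    (h.integrable_pathVal A hM) (fun n => Eventually.of_forall fun ω => ?_)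
    (Eventually.of_forall fun ω => ?_)
  · refine (norm_indicator_le_norm_self _ _).trans ?_
    rw [Real.norm_of_nonneg (pathVal_nonneg _ _ _)]
  · by_cases hω : ∃ r, X ω r ∈ A
    · obtain ⟨r, hr⟩ := hω
      refine tendsto_const_nhds.congr' ?_
      filter_upwards [eventually_ge_atTop ⌈r⌉₊] with n hn
      rw [Set.indicator_of_mem]
      exact ⟨r, Nat.ceil_le.1 hn, hr⟩
    · have h1 : pathVal A M (X ω) = 0 := by
        rw [pathVal_eq hA hM hAM (h.cont ω), hitVal_of_not_hit (not_exists.1 hω)]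
      have h2 : ∀ n : ℕ, (hitSet A X n).indicator (fun ω => pathVal A M (X ω)) ω = 0 := fun n =>
        Set.indicator_of_notMem (fun h => hω (h.imp fun _ h => h.2)) _
      simp only [h1, h2]
      exact tendsto_const_nhds

lemma IsBM.height_le_im (h : IsBM P X z) (hΛ : IsBMLaw Λ) (hA : IsClosed A)
    (h0 : {z : ℂ | z.im ≤ 0} ⊆ A) (hM : 0 ≤ M) (hAM : ∀ z ∈ A, z.im ≤ M) (hz : 0 ≤ z.im) :
    height Λ A M z ≤ z.im := by
  refine le_of_tendsto' (h.tendsto_setIntegral_hitSet hΛ hA hM hAM) fun n => ?_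
  have h1 := h.integral_hitSet_add hA h0 hM hAM hz n
  have h2 : 0 ≤ ∫ ω in (hitSet A X n)ᶜ, (X ω n).im ∂P :=
    setIntegral_nonneg (h.measurableSet_hitSet hA n).compl
      fun ω hω => im_nonneg_of_notMem_hitSet h0 hω
  linarith

lemma IsBM.height_mono (h : IsBM P X z) (hΛ : IsBMLaw Λ) {A' : Set ℂ} (hA : IsClosed A)
    (hA' : IsClosed A') (hAA' : A ⊆ A')
    (h0 : {z : ℂ | z.im ≤ 0} ⊆ A) (hM : 0 ≤ M) (hAM : ∀ z ∈ A', z.im ≤ M) (hz : 0 ≤ z.im) :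
    height Λ A M z ≤ height Λ A' M z := by
  refine le_of_tendsto_of_tendsto' (h.tendsto_setIntegral_hitSet hΛ hA hM fun z hz => hAM z (hAA' hz))
    (h.tendsto_setIntegral_hitSet hΛ hA' hM hAM) fun n => ?_
  have h1 := h.integral_hitSet_add hA h0 hM (fun z hz => hAM z (hAA' hz)) hz n
  have h2 := h.integral_hitSet_add hA' (h0.trans hAA') hM hAM hz n
  have h3 : ∫ ω in (hitSet A' X n)ᶜ, (X ω n).im ∂P ≤ ∫ ω in (hitSet A X n)ᶜ, (X ω n).im ∂P := by
    refine setIntegral_mono_set (h.integrable_im n).integrableOn ?_ ?_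
    · exact (ae_restrict_iff' (h.measurableSet_hitSet hA n).compl).2
        (Eventually.of_forall fun ω hω => im_nonneg_of_notMem_hitSet h0 hω)
    · have hsub : hitSet A X n ⊆ hitSet A' X n := fun ω ⟨r, hr, hrA⟩ => ⟨r, hr, hAA' hrA⟩
      exact (Set.compl_subset_compl.2 hsub).eventuallyLE
  linarith

lemma IsBM.height_lt (h : IsBM P X z) (hΛ : IsBMLaw Λ) {A' : Set ℂ} (hA : IsClosed A)
    (hA' : IsClosed A') (hAA' : A ⊆ A')
    (h0 : {z : ℂ | z.im ≤ 0} ⊆ A) (hM : 0 ≤ M) (hAM : ∀ z ∈ A', z.im ≤ M) (hz : 0 ≤ z.im)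
    (hX : ∀ x : ℂ, ∃ (P : Measure Ω) (X : Ω → ℝ≥0 → ℂ), IsBM P X x) {t : ℝ≥0}
    (hpos : P (hitSet A' X t ∩ (hitSet A X t)ᶜ ∩ {ω | M < (X ω t).im}) ≠ 0) :
    height Λ A M z < height Λ A' M z := by
  have hAM' : ∀ z ∈ A, z.im ≤ M := fun z hz => hAM z (hAA' hz)
  have hB := h.measurableSet_hitSet hA t
  have hB' := h.measurableSet_hitSet hA' t
  have hi : ∀ C, Integrable (fun ω => (X ω t).im - height Λ C M (X ω t)) P := fun C =>
    (h.integrable_im t).sub (h.integrable_height C hM (h.measurable_eval t))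
  rw [h.height_eq_sub hΛ hA h0 hM hAM' hz t, h.height_eq_sub hΛ hA' (h0.trans hAA') hM hAM hz t]
  have hsub : hitSet A X t ⊆ hitSet A' X t := fun ω ⟨r, hr, hrA⟩ => ⟨r, hr, hAA' hrA⟩
  have hsplit : (hitSet A X t)ᶜ = (hitSet A' X t ∩ (hitSet A X t)ᶜ) ∪ (hitSet A' X t)ᶜ := by
    ext ω
    have := @hsub ω
    simp only [Set.mem_compl_iff, Set.mem_union, Set.mem_inter_iff]
    tauto
  rw [hsplit, setIntegral_union (disjoint_compl_right.mono_left Set.inter_subset_left) hB'.compl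
    (hi A).integrableOn (hi A).integrableOn]
  have hle : ∀ ω ∈ (hitSet A X t)ᶜ, 0 ≤ (X ω t).im - height Λ A M (X ω t) := fun ω hω => by
    obtain ⟨P', X', h'⟩ := hX (X ω t)
    exact sub_nonneg.2 (h'.height_le_im hΛ hA h0 hM hAM' (im_nonneg_of_notMem_hitSet h0 hω))
  have h1 : ∫ ω in (hitSet A' X t)ᶜ, ((X ω t).im - height Λ A' M (X ω t)) ∂P ≤
      ∫ ω in (hitSet A' X t)ᶜ, ((X ω t).im - height Λ A M (X ω t)) ∂P := by
    refine setIntegral_mono_on (hi A').integrableOn (hi A).integrableOn hB'.compl fun ω hω => ?_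
    obtain ⟨P', X', h'⟩ := hX (X ω t)
    exact sub_le_sub_left (h'.height_mono hΛ hA hA' hAA' h0 hM hAM
      (im_nonneg_of_notMem_hitSet (h0.trans hAA') hω)) _
  have h2 : 0 < ∫ ω in hitSet A' X t ∩ (hitSet A X t)ᶜ, ((X ω t).im - height Λ A M (X ω t)) ∂P := by
    rw [setIntegral_pos_iff_support_of_nonneg_ae _ (hi A).integrableOn]
    · refine (pos_iff_ne_zero.2 hpos).trans_le (measure_mono ?_)
      rintro ω ⟨⟨h3, h4⟩, h5⟩
      refine ⟨?_, h3, h4⟩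
      have h6 := height_le Λ A hM (X ω t)
      have h7 : M < (X ω t).im := h5
      exact (sub_pos.2 (h6.trans_lt h7)).ne'
    · exact (ae_restrict_iff' (hB'.inter hB.compl)).2 (Eventually.of_forall fun ω hω => hle ω hω.2)
  linarith

end

/-! ### The Cauchy distribution -/

lemma integral_cauchyMeasure {E : Type*} [NormedAddCommGroup E] [NormedSpace ℝ E] {γ : ℝ≥0}
    (hγ : γ ≠ 0) (f : ℝ → E) :
    ∫ x, f x ∂ProbabilityTheory.cauchyMeasure 0 γ =
      ∫ x, ProbabilityTheory.cauchyPDFReal 0 γ x • f x := by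
  rw [ProbabilityTheory.cauchyMeasure_of_scale_ne_zero 0 hγ,
    integral_withDensity_eq_integral_toReal_smul (ProbabilityTheory.measurable_cauchyPDF 0 γ)
      (Eventually.of_forall fun x => ENNReal.ofReal_lt_top)]
  simp only [ProbabilityTheory.cauchyPDF,
    ENNReal.toReal_ofReal (ProbabilityTheory.cauchyPDF_pos 0 hγ _).le]

open scoped FourierTransform in
lemma fourier_exp_neg_abs {γ : ℝ≥0} (hγ : γ ≠ 0) :
    𝓕 (fun x : ℝ => Complex.exp (-(2 * Real.pi * γ * |x| : ℝ))) =
      fun w => (ProbabilityTheory.cauchyPDFReal 0 γ w : ℂ) := by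
  ext w
  have hγ' : (0 : ℝ) < γ := NNReal.coe_pos.2 (pos_iff_ne_zero.2 hγ)
  have hpi := Real.pi_pos
  rw [Real.fourier_real_eq_integral_exp_smul]
  set p : ℂ := (2 * Real.pi * γ : ℝ) - (2 * Real.pi * w : ℝ) * Complex.I with hp
  set q : ℂ := -(2 * Real.pi * γ : ℝ) - (2 * Real.pi * w : ℝ) * Complex.I with hq
  have hpre : 0 < p.re := by simp [hp]; positivity
  have hqre : q.re < 0 := by simp [hq]; positivity
  have e1 : ∀ v ∈ Set.Iic (0 : ℝ), Complex.exp (↑(-2 * Real.pi * v * w) * Complex.I) •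
      Complex.exp (-(2 * Real.pi * γ * |v| : ℝ)) = Complex.exp (p * v) := fun v hv => by
    rw [abs_of_nonpos hv, smul_eq_mul, ← Complex.exp_add, hp]
    congr 1
    push_cast
    ring
  have e2 : ∀ v ∈ Set.Ioi (0 : ℝ), Complex.exp (↑(-2 * Real.pi * v * w) * Complex.I) •
      Complex.exp (-(2 * Real.pi * γ * |v| : ℝ)) = Complex.exp (q * v) := fun v hv => by
    rw [abs_of_pos hv, smul_eq_mul, ← Complex.exp_add, hq]
    congr 1
    push_cast
    ring
  have i1 := (integrableOn_exp_mul_complex_Iic hpre 0).congr_fun (fun v hv => (e1 v hv).symm)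
    measurableSet_Iic
  have i2 := (integrableOn_exp_mul_complex_Ioi hqre 0).congr_fun (fun v hv => (e2 v hv).symm)
    measurableSet_Ioi
  rw [← intervalIntegral.integral_Iic_add_Ioi i1 i2, setIntegral_congr_fun measurableSet_Iic e1,
    setIntegral_congr_fun measurableSet_Ioi e2, integral_exp_mul_complex_Iic hpre,
    integral_exp_mul_complex_Ioi hqre, ProbabilityTheory.cauchyPDFReal_def]
  have hp0 : p ≠ 0 := fun h => by simp [h] at hpre
  have hq0 : q ≠ 0 := fun h => by simp [h] at hqre
  have hpq : p * q = -(4 * Real.pi ^ 2 * (w ^ 2 + γ ^ 2) : ℝ) := by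
    rw [hp, hq]
    push_cast
    linear_combination (4 * Real.pi ^ 2 * w ^ 2 : ℂ) * Complex.I_sq
  have hqp : q - p = -(4 * Real.pi * γ : ℝ) := by
    rw [hp, hq]
    push_cast
    ring
  have hs : ((w ^ 2 + γ ^ 2 : ℝ) : ℂ) ≠ 0 := by
    exact_mod_cast (by positivity : w ^ 2 + (γ : ℝ) ^ 2 ≠ 0)
  have hpi' : ((Real.pi : ℝ) : ℂ) ≠ 0 := by exact_mod_cast hpi.ne'
  calc Complex.exp (p * (0 : ℝ)) / p + -Complex.exp (q * (0 : ℝ)) / q = (q - p) / (p * q) := by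
        simp
        field_simp
        ring
    _ = _ := by
        rw [hpq, hqp]
        push_cast at hs ⊢
        rw [sub_zero]
        field_simp
        

lemma integrable_exp_neg_abs {γ : ℝ≥0} (hγ : γ ≠ 0) :
    Integrable (fun x : ℝ => Complex.exp (-(2 * Real.pi * γ * |x| : ℝ))) := by
  have hγ' : (0 : ℝ) < γ := NNReal.coe_pos.2 (pos_iff_ne_zero.2 hγ)
  have hpi := Real.pi_pos
  have hpre : 0 < ((2 * Real.pi * γ : ℝ) : ℂ).re := by
    rw [Complex.ofReal_re]
    positivity
  have hqre : (-((2 * Real.pi * γ : ℝ) : ℂ)).re < 0 := by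
    rw [Complex.neg_re]
    linarith
  rw [← integrableOn_univ, ← Set.Iic_union_Ioi (a := (0 : ℝ))]
  refine ((integrableOn_exp_mul_complex_Iic hpre 0).congr_fun (fun v hv => ?_)
    measurableSet_Iic).union ((integrableOn_exp_mul_complex_Ioi hqre 0).congr_fun (fun v hv => ?_)
    measurableSet_Ioi)
  · simp only [abs_of_nonpos (Set.mem_Iic.1 hv)]
    congr 1
    push_cast
    ring
  · simp only [abs_of_pos (Set.mem_Ioi.1 hv)]
    congr 1
    push_cast
    ring

open scoped FourierTransform in
lemma charFun_cauchyMeasure {γ : ℝ≥0} (hγ : γ ≠ 0) (θ : ℝ) :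
    charFun (ProbabilityTheory.cauchyMeasure 0 γ) θ = Complex.exp (-(γ * |θ| : ℝ)) := by
  have hc : Continuous fun x : ℝ => Complex.exp (-(2 * Real.pi * γ * |x| : ℝ)) := by fun_prop
  have h1 := hc.fourierInv_fourier_eq (integrable_exp_neg_abs hγ) (by
    rw [fourier_exp_neg_abs hγ]
    exact (ProbabilityTheory.integrable_cauchyPDFReal 0).ofReal)
  have h2 := congrFun h1 (θ / (2 * Real.pi))
  rw [fourier_exp_neg_abs hγ, Real.fourierInv_eq'] at h2
  rw [charFun_apply_real, integral_cauchyMeasure hγ]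
  have hpi := Real.pi_pos
  refine Eq.trans ?_ (h2.trans ?_)
  · congr 1
    ext x
    rw [Complex.real_smul, smul_eq_mul, mul_comm]
    congr 2
    rw [← Complex.ofReal_mul]
    congr 2
    simp
    field_simp
  · congr 3
    rw [abs_div, abs_of_pos (by positivity : 0 < 2 * Real.pi)]
    field_simp

/-! ### Exit from a half-plane -/

lemma gaussianReal_eq_map (m : ℝ) (v : ℝ≥0) :
    ProbabilityTheory.gaussianReal m v =
      (ProbabilityTheory.gaussianReal 0 1).map fun x => m + √v * x := by
  have h1 := ProbabilityTheory.gaussianReal_map_const_mul (μ := 0) (v := 1) (√v)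
  have h2 := ProbabilityTheory.gaussianReal_map_const_add (μ := 0) (v := v) m
  have hv : NNReal.mk (√v ^ 2) (sq_nonneg _) * 1 = v := by
    ext
    simp
  rw [hv, mul_zero] at h1
  rw [zero_add] at h2
  rw [← h2, ← h1, Measure.map_map (by fun_prop) (by fun_prop)]
  rfl

lemma map_im_gam (v : ℝ≥0) : (gam v).map Complex.im = ProbabilityTheory.gaussianReal 0 v := by
  rw [gam, Measure.map_map Complex.measurable_im measurable_equivRealProd_symm]
  have h : (Complex.im ∘ fun p : ℝ × ℝ => Complex.equivRealProd.symm p) = Prod.snd := by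
    ext p
    simp
  rw [h]
  exact measurePreserving_snd.map_eq

lemma tendsto_integral_exp_neg_gaussianReal (m : ℝ) {θ : ℝ} (hθ : 0 < θ) :
    Tendsto (fun n : ℕ => ∫ x, Real.exp (-(θ * |x|)) ∂ProbabilityTheory.gaussianReal m n) atTop
      (𝓝 0) := by
  have h1 : ∀ n : ℕ, ∫ x, Real.exp (-(θ * |x|)) ∂ProbabilityTheory.gaussianReal m n =
      ∫ x, Real.exp (-(θ * |m + √n * x|)) ∂ProbabilityTheory.gaussianReal 0 1 := fun n => by
    rw [gaussianReal_eq_map m n, integral_map (by fun_prop) (by fun_prop)]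
    simp
  simp only [h1]
  suffices hlim : Tendsto (fun n : ℕ => ∫ x, Real.exp (-(θ * |m + √n * x|))
      ∂ProbabilityTheory.gaussianReal 0 1) atTop
      (𝓝 (∫ _, (0 : ℝ) ∂ProbabilityTheory.gaussianReal 0 1)) by
    simpa using hlim
  refine tendsto_integral_of_dominated_convergence (fun _ => 1)
    (fun n => Continuous.aestronglyMeasurable (by fun_prop))
    (integrable_const 1) (fun n => Eventually.of_forall fun x => ?_) ?_
  · rw [Real.norm_of_nonneg (Real.exp_pos _).le, Real.exp_le_one_iff]
    have := abs_nonneg (m + √n * x)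
    nlinarith
  · have := ProbabilityTheory.nullSingletonClass_gaussianReal (μ := 0) (v := 1) one_ne_zero
    have h0 : ∀ᵐ x ∂ProbabilityTheory.gaussianReal 0 1, x ≠ 0 := by
      simp [ae_iff]
    filter_upwards [h0] with x hx
    have h2 : Tendsto (fun n : ℕ => √(n : ℝ)) atTop atTop :=
      Real.tendsto_sqrt_atTop.comp tendsto_natCast_atTop_atTop
    have h3 : Tendsto (fun n : ℕ => |√(n : ℝ) * x| - |m|) atTop atTop := by
      simp only [abs_mul, abs_of_nonneg (Real.sqrt_nonneg _)]
      exact tendsto_atTop_add_const_right _ _ (h2.atTop_mul_const (abs_pos.2 hx))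
    have h4 : Tendsto (fun n : ℕ => |m + √(n : ℝ) * x|) atTop atTop :=
      tendsto_atTop_mono (fun n => by
        have := abs_sub_abs_le_abs_sub (√(n : ℝ) * x) (-m)
        rw [abs_neg, sub_neg_eq_add, add_comm (√(n : ℝ) * x)] at this
        exact this) h3
    exact Real.tendsto_exp_neg_atTop_nhds_zero.comp (h4.const_mul_atTop hθ)

/-- The complement of the half-plane above height `M`. -/
def lower (M : ℝ) : Set ℂ := {z | z.im ≤ M}

lemma isClosed_lower (M : ℝ) : IsClosed (lower M) :=
  isClosed_le Complex.continuous_im continuous_const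

section
variable {Ω : Type*} [MeasurableSpace Ω] {P : Measure Ω} {X : Ω → ℝ≥0 → ℂ} {z : ℂ} {M : ℝ}

lemma IsBM.map_im_eval (h : IsBM P X z) (t : ℝ≥0) :
    P.map (fun ω => (X ω t).im) = ProbabilityTheory.gaussianReal z.im t := by
  have h1 : P.map (fun ω => (X ω t).im) = (P.map fun ω => X ω t).map Complex.im := by
    rw [Measure.map_map Complex.measurable_im (h.measurable_eval t)]
    rfl
  rw [h1, h.map_eval, Measure.map_map Complex.measurable_im (measurable_const_add z)]
  have h2 : (Complex.im ∘ fun w => z + w) = (fun x => z.im + x) ∘ Complex.im := by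
    ext w
    simp
  rw [h2, ← Measure.map_map (measurable_const_add _) Complex.measurable_im, map_im_gam,
    ProbabilityTheory.gaussianReal_map_const_add, zero_add]

lemma norm_exp_le_of_le_im {θ : ℝ} (hθ : 0 ≤ θ) {x : ℂ} (hx : M ≤ x.im) :
    ‖Complex.exp (Complex.I * θ * (x - Complex.I * M))‖ ≤ 1 := by
  rw [Complex.norm_exp, Real.exp_le_one_iff]
  simp
  nlinarith

lemma IsBM.measure_hit_lower (h : IsBM P X z) (hz : M < z.im) :
    ∀ᵐ ω ∂P, ∃ r, X ω r ∈ lower M := by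
  have := h.prob
  set B : Set Ω := ⋃ n : ℕ, hitSet (lower M) X n with hB
  have hBm : MeasurableSet B :=
    MeasurableSet.iUnion fun n => h.measurableSet_hitSet (isClosed_lower M) n
  have key : ∀ θ : ℝ, 0 < θ → Real.exp (-(θ * (z.im - M))) ≤ P.real B := fun θ hθ => by
    have hlim := (tendsto_integral_exp_neg_gaussianReal (z.im - M) hθ).const_add (P.real B)
    rw [add_zero] at hlim
    refine ge_of_tendsto' hlim fun n => ?_
    obtain ⟨hi, he⟩ := h.integral_capTime (gaussMean_exp θ M) (isClosed_lower M) n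
    have h1 : ‖Complex.exp (Complex.I * θ * (z - Complex.I * M))‖ =
        Real.exp (-(θ * (z.im - M))) := by
      rw [Complex.norm_exp]
      simp
    rw [← h1, ← he]
    have hmi : Measurable fun ω => (X ω n).im :=
      Complex.measurable_im.comp (h.measurable_eval _)
    have h2 : ∫ x, Real.exp (-(θ * |x|)) ∂ProbabilityTheory.gaussianReal (z.im - M) n =
        ∫ ω, Real.exp (-(θ * |(X ω n).im - M|)) ∂P := by
      rw [← ProbabilityTheory.gaussianReal_map_sub_const M, ← h.map_im_eval,
        integral_map (by fun_prop) (by fun_prop), integral_map hmi.aemeasurable (by fun_prop)]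
    have hcm : Measurable fun ω => Real.exp (-(θ * |(X ω n).im - M|)) :=
      (by fun_prop : Continuous fun x : ℝ => Real.exp (-(θ * |x - M|))).measurable.comp
        (Complex.measurable_im.comp (h.measurable_eval _))
    have hi2 : Integrable (fun ω => Real.exp (-(θ * |(X ω n).im - M|))) P := by
      refine Integrable.of_bound hcm.aestronglyMeasurable 1 (Eventually.of_forall fun ω => ?_)
      rw [Real.norm_of_nonneg (Real.exp_pos _).le, Real.exp_le_one_iff]
      have := abs_nonneg ((X ω n).im - M)
      nlinarith
    have hi3 : Integrable (B.indicator fun _ => (1 : ℝ)) P := (integrable_const 1).indicator hBm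
    refine (norm_integral_le_integral_norm _).trans ?_
    rw [h2, ← integral_indicator_one hBm]
    refine le_trans (integral_mono hi.norm (hi3.add hi2) fun ω => ?_) (integral_add hi3 hi2).le
    have hle := le_im_capTime (A := lower M) le_rfl (h.cont ω) (by rw [h.start]; exact hz.le) n
    by_cases hω : ω ∈ hitSet (lower M) X n
    · simp only [Pi.add_apply]
      rw [Set.indicator_of_mem (Set.mem_iUnion.2 ⟨n, hω⟩)]
      have := Real.exp_pos (-(θ * |(X ω n).im - M|))
      linarith [norm_exp_le_of_le_im hθ.le hle]
    · have hc : capTime (lower M) n (X ω) = n :=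
        capTime_eq_of_not_hit fun r hr hrA => hω ⟨r, hr, hrA⟩
      rw [hc] at hle
      simp only [Pi.add_apply, hc]
      have h4 : ‖Complex.exp (Complex.I * θ * (X ω n - Complex.I * M))‖ =
          Real.exp (-(θ * |(X ω n).im - M|)) := by
        rw [Complex.norm_exp, abs_of_nonneg (sub_nonneg.2 hle)]
        simp
      rw [h4]
      exact le_add_of_nonneg_left (Set.indicator_nonneg (fun _ _ => zero_le_one) ω)
  have h5 : 1 ≤ P.real B := by
    have h6 : Tendsto (fun n : ℕ => Real.exp (-((1 / ((n : ℝ) + 1)) * (z.im - M)))) atTop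
        (𝓝 (Real.exp (-(0 * (z.im - M))))) :=
      (Real.continuous_exp.tendsto _).comp
        ((tendsto_one_div_add_atTop_nhds_zero_nat.mul_const _).neg)
    rw [zero_mul, neg_zero, Real.exp_zero] at h6
    exact le_of_tendsto' h6 fun n => key _ (by positivity)
  have h7 : P B = 1 := by
    refine le_antisymm prob_le_one ?_
    rw [Measure.real] at h5
    exact (ENNReal.ofReal_one ▸ ENNReal.ofReal_le_iff_le_toReal (measure_ne_top P B)).2 h5
  filter_upwards [(mem_ae_iff_prob_eq_one hBm).2 h7] with ω hω
  obtain ⟨n, r, _, hr⟩ := Set.mem_iUnion.1 hω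
  exact ⟨r, hr⟩

end

/-! ### The Poisson formula on a half-plane -/

/-- The position of a path when it first hits the half-plane below height `M`. -/
noncomputable def exitPt (M : ℝ) (w : ℝ≥0 → ℂ) : ℂ := w (sInf {r | w r ∈ lower M})

lemma capTime_lower_eventually_eq {M : ℝ} {w : ℝ≥0 → ℂ} (h : ∃ r, w r ∈ lower M) :
    ∀ᶠ n : ℕ in atTop, w (capTime (lower M) n w) = exitPt M w := by
  obtain ⟨r, hr⟩ := h
  filter_upwards [eventually_ge_atTop ⌈r⌉₊] with n hn
  have hrn : r ≤ n := (Nat.le_ceil r).trans (by exact_mod_cast hn)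
  rw [exitPt, capTime_eq_sInf ⟨r, hrn, hr⟩]

lemma im_exitPt {M : ℝ} {w : ℝ≥0 → ℂ} (hw : Continuous w) (h0 : M ≤ (w 0).im)
    (h : ∃ r, w r ∈ lower M) : (exitPt M w).im = M := by
  obtain ⟨r, hr⟩ := h
  have h1 : capTime (lower M) r w = sInf {r | w r ∈ lower M} := capTime_eq_sInf ⟨r, le_rfl, hr⟩
  refine le_antisymm ?_ ?_
  · have := capTime_mem_of_hit (isClosed_lower M) hw ⟨r, le_rfl, hr⟩
    rwa [h1] at this
  · have := le_im_capTime (A := lower M) le_rfl hw h0 r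
    rwa [h1] at this

section
variable {Ω : Type*} [MeasurableSpace Ω] {P : Measure Ω} {X : Ω → ℝ≥0 → ℂ} {z : ℂ} {M : ℝ}

lemma IsBM.aemeasurable_exitPt (h : IsBM P X z) (hz : M < z.im) :
    AEMeasurable (fun ω => exitPt M (X ω)) P := by
  refine aemeasurable_of_tendsto_metrizable_ae atTop
    (f := fun n : ℕ => fun ω => X ω (capTime (lower M) n (X ω)))
    (fun n => (h.measurable_eval_capTime (isClosed_lower M) n).aemeasurable) ?_
  filter_upwards [h.measure_hit_lower hz] with ω hω
  exact tendsto_nhds_of_eventually_eq (capTime_lower_eventually_eq hω)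

lemma IsBM.tendsto_integral_exitPt {E : Type*} [NormedAddCommGroup E] [NormedSpace ℝ E]
    (h : IsBM P X z) (hz : M < z.im) {f : ℂ → E}
    (hf : StronglyMeasurable f) {C : ℝ} (hC : ∀ x, M ≤ x.im → ‖f x‖ ≤ C) :
    Tendsto (fun n : ℕ => ∫ ω, f (X ω (capTime (lower M) n (X ω))) ∂P) atTop
      (𝓝 (∫ ω, f (exitPt M (X ω)) ∂P)) := by
  have := h.prob
  refine tendsto_integral_of_dominated_convergence (fun _ => C)
    (fun n => (hf.comp_measurable
      (h.measurable_eval_capTime (isClosed_lower M) n)).aestronglyMeasurable)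
    (integrable_const C) (fun n => Eventually.of_forall fun ω => hC _ ?_) ?_
  · exact le_im_capTime (A := lower M) le_rfl (h.cont ω) (by rw [h.start]; exact hz.le) n
  · filter_upwards [h.measure_hit_lower hz] with ω hω
    refine tendsto_nhds_of_eventually_eq ?_
    filter_upwards [capTime_lower_eventually_eq hω] with n hn
    rw [hn]

/-- The exit position of Brownian motion from a half-plane has a Cauchy distribution. -/
lemma IsBM.map_exitPt (h : IsBM P X z) {γ : ℝ≥0} (hγ : γ ≠ 0) (hz : z.im = M + γ)
    (hre : z.re = 0) :
    P.map (fun ω => (exitPt M (X ω)).re) = ProbabilityTheory.cauchyMeasure 0 γ := by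
  have := h.prob
  have hγ' : (0 : ℝ) < γ := by positivity
  have hzM : M < z.im := by linarith
  have hm := h.aemeasurable_exitPt hzM
  have hmr : AEMeasurable (fun ω => (exitPt M (X ω)).re) P :=
    Complex.measurable_re.comp_aemeasurable hm
  have := Measure.isProbabilityMeasure_map hmr
  have key : ∀ θ : ℝ, 0 ≤ θ → charFun (P.map fun ω => (exitPt M (X ω)).re) θ =
      charFun (ProbabilityTheory.cauchyMeasure 0 γ) θ := fun θ hθ => by
    rw [charFun_cauchyMeasure hγ, charFun_apply_real, integral_map hmr (by fun_prop)]
    have hlim := h.tendsto_integral_exitPt hzM (gaussMean_exp θ M).cont.stronglyMeasurable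
      (C := 1) fun x hx => norm_exp_le_of_le_im hθ hx
    have h1 : ∀ n : ℕ, ∫ ω, Complex.exp (Complex.I * θ *
        (X ω (capTime (lower M) n (X ω)) - Complex.I * M)) ∂P =
        Complex.exp (-(γ * |θ| : ℝ)) := fun n => by
      rw [(h.integral_capTime (gaussMean_exp θ M) (isClosed_lower M) n).2, abs_of_nonneg hθ]
      congr 1
      apply Complex.ext <;> simp [hre, hz]
      ring
    simp only [h1] at hlim
    rw [tendsto_nhds_unique tendsto_const_nhds hlim]
    refine integral_congr_ae ?_
    filter_upwards [h.measure_hit_lower hzM] with ω hω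
    have h2 := im_exitPt (h.cont ω) (by rw [h.start]; exact hzM.le) hω
    congr 1
    apply Complex.ext <;> simp [h2]
  refine Measure.ext_of_charFun (funext fun θ => ?_)
  rcases le_total 0 θ with hθ | hθ
  · exact key θ hθ
  · have h3 := key (-θ) (neg_nonneg.2 hθ)
    rw [charFun_neg, charFun_neg] at h3
    exact (starRingEnd ℂ).injective h3

variable {Λ : Measure (ℝ≥0 → ℂ)} [IsProbabilityMeasure Λ] {A : Set ℂ}

lemma IsBM.height_eq_integral_cauchyMeasure (h : IsBM P X z) (hΛ : IsBMLaw Λ) (hA : IsClosed A)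
    (hM : 0 ≤ M) (hAM : ∀ z ∈ A, z.im ≤ M)
    {γ : ℝ≥0} (hγ : γ ≠ 0) (hz : z.im = M + γ) (hre : z.re = 0) :
    height Λ A M z =
      ∫ s : ℝ, height Λ A M (s + M * Complex.I) ∂ProbabilityTheory.cauchyMeasure 0 γ := by
  have hzM : M < z.im := by
    have : (0 : ℝ) < γ := by positivity
    linarith
  have hlim := h.tendsto_integral_exitPt hzM (measurable_height Λ A M).stronglyMeasurable
    (C := M) fun x _ => by
      rw [Real.norm_of_nonneg (height_nonneg Λ A M x)]
      exact height_le Λ A hM x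
  have h1 : ∀ n : ℕ, ∫ ω, height Λ A M (X ω (capTime (lower M) n (X ω))) ∂P =
      height Λ A M z := fun n => by
    have h2 := h.integral_shift_capTime hΛ (isClosed_lower M) n (measurable_pathVal A M)
      (pathVal_nonneg A M) (pathVal_le A hM)
    rw [← h.integral_pathVal hΛ A hM]
    refine h2.symm.trans (integral_congr_ae (Eventually.of_forall fun ω => ?_))
    have hc : Continuous fun u => X ω (capTime (lower M) n (X ω) + u) :=
      (h.cont ω).comp (continuous_const.add continuous_id)
    beta_reduce
    rw [pathVal_eq hA hM hAM hc, pathVal_eq hA hM hAM (h.cont ω)]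
    exact hitVal_shift fun r hr hrA => notMem_of_lt_capTime hr (hAM _ hrA)
  simp only [h1] at hlim
  rw [tendsto_nhds_unique tendsto_const_nhds hlim, ← h.map_exitPt hγ hz hre]
  have hmr : AEMeasurable (fun ω => (exitPt M (X ω)).re) P :=
    Complex.measurable_re.comp_aemeasurable (h.aemeasurable_exitPt hzM)
  have hmh : Measurable fun s : ℝ => height Λ A M (s + M * Complex.I) :=
    (measurable_height Λ A M).comp (by fun_prop)
  rw [integral_map hmr hmh.aestronglyMeasurable]
  refine integral_congr_ae ?_
  filter_upwards [h.measure_hit_lower hzM] with ω hω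
  have h2 := im_exitPt (h.cont ω) (by rw [h.start]; exact hzM.le) hω
  congr 1
  apply Complex.ext <;> simp [h2]

end

lemma mul_integral_cauchyMeasure_mono {k : ℝ → ℝ} (hk : Measurable k) (hk0 : ∀ s, 0 ≤ k s) {C : ℝ}
    (hkC : ∀ s, k s ≤ C) {γ γ' : ℝ≥0} (hγ : γ ≠ 0) (hγγ' : γ ≤ γ') :
    γ * ∫ s, k s ∂ProbabilityTheory.cauchyMeasure 0 γ ≤
      γ' * ∫ s, k s ∂ProbabilityTheory.cauchyMeasure 0 γ' := by
  have hγ' : γ' ≠ 0 := (lt_of_lt_of_le (pos_iff_ne_zero.2 hγ) hγγ').ne'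
  have hi : ∀ δ : ℝ≥0, Integrable (fun s => ProbabilityTheory.cauchyPDFReal 0 δ s • k s) := fun δ =>
    (ProbabilityTheory.integrable_cauchyPDFReal (γ := δ) 0).mul_bdd (c := C) hk.aestronglyMeasurable
      (Eventually.of_forall fun s => by rw [Real.norm_of_nonneg (hk0 s)]; exact hkC s)
  rw [integral_cauchyMeasure hγ, integral_cauchyMeasure hγ', ← integral_const_mul,
    ← integral_const_mul]
  refine integral_mono ((hi γ).const_mul _) ((hi γ').const_mul _) fun s => ?_
  have h1 : (0 : ℝ) < γ := by positivity
  have h2 : (γ : ℝ) ≤ γ' := by exact_mod_cast hγγ'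
  have h3 : (0 : ℝ) < γ' := h1.trans_le h2
  simp only [ProbabilityTheory.cauchyPDFReal_def, smul_eq_mul, sub_zero]
  have h4 : (γ : ℝ) * γ * (s ^ 2 + γ ^ 2)⁻¹ ≤ γ' * γ' * (s ^ 2 + γ' ^ 2)⁻¹ := by
    rw [← div_eq_mul_inv, ← div_eq_mul_inv, div_le_div_iff₀ (by positivity) (by positivity)]
    nlinarith [mul_le_mul h2 h2 h1.le h3.le, sq_nonneg s,
      mul_le_mul_of_nonneg_left (mul_le_mul h2 h2 h1.le h3.le) (sq_nonneg s)]
  have h5 := mul_le_mul_of_nonneg_left h4 (mul_nonneg (inv_nonneg.2 Real.pi_pos.le) (hk0 s))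
  calc _ = Real.pi⁻¹ * k s * ((γ : ℝ) * γ * (s ^ 2 + γ ^ 2)⁻¹) := by ring
    _ ≤ _ := h5
    _ = _ := by ring

/-! ### Monotonicity of the capacity -/

lemma exists_tendsto_of_monotone_sub {f g : ℝ → ℝ} {M c : ℝ}
    (hf : MonotoneOn f (Set.Ioi M)) (hgf : MonotoneOn (fun y => g y - f y) (Set.Ioi M))
    (hle : ∀ y, M < y → f y ≤ g y) (hg : Tendsto g atTop (𝓝 c)) :
    ∃ a, Tendsto f atTop (𝓝 a) ∧ ∀ y, M < y → g y - f y ≤ c - a := by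
  have hgm : MonotoneOn g (Set.Ioi M) := fun x hx y hy hxy => by
    have h1 := hf hx hy hxy
    have h2 := hgf hx hy hxy
    simp only at h2
    linarith
  have hgc : ∀ y, M < y → g y ≤ c := fun y hy => by
    refine ge_of_tendsto hg ?_
    filter_upwards [eventually_ge_atTop y] with x hx
    exact hgm hy (hy.trans_le hx) hx
  have hmax : ∀ x : ℝ, M < max x (M + 1) := fun x => lt_max_of_lt_right (lt_add_one M)
  have hφ : Monotone fun x => f (max x (M + 1)) := fun x y hxy =>
    hf (hmax x) (hmax y) (max_le_max_right _ hxy)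
  have hb : BddAbove (Set.range fun x => f (max x (M + 1))) :=
    ⟨c, by rintro _ ⟨x, rfl⟩; exact (hle _ (hmax x)).trans (hgc _ (hmax x))⟩
  have hlim : Tendsto f atTop (𝓝 (⨆ x, f (max x (M + 1)))) := by
    refine (tendsto_atTop_ciSup hφ hb).congr' ?_
    filter_upwards [eventually_ge_atTop (M + 1)] with x hx
    rw [max_eq_left hx]
  refine ⟨_, hlim, fun y hy => ge_of_tendsto (hg.sub hlim) ?_⟩
  filter_upwards [eventually_ge_atTop y] with x hx
  exact hgf hy (hy.trans_le hx) hx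

section
variable {Ω : Type*} [MeasurableSpace Ω] (BM : PlanarBM Ω) {Λ : Measure (ℝ≥0 → ℂ)}
  [IsProbabilityMeasure Λ] {F F' : Set ℂ} {M : ℝ}

lemma im_le_of_mem_absorbing (hM : 0 ≤ M) (hFM : ∀ z ∈ F, z.im ≤ M) :
    ∀ z ∈ absorbing F, z.im ≤ M := by
  rintro z (hz | hz)
  · exact hFM z hz
  · exact le_trans hz hM

lemma integral_imAtHit (hΛ : IsBMLaw Λ) (hFU : F ⊆ UH) (hF : closure F ∩ UH = F)
    (hM : 0 ≤ M) (hFM : ∀ z ∈ F, z.im ≤ M) (z : ℂ) :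
    ∫ ω, imAtHit (fun t => BM.Z t ω) F ∂BM.P z = height Λ (absorbing F) M z := by
  obtain ⟨X, hX, hXZ⟩ := exists_isBM BM z
  rw [← hX.integral_pathVal hΛ _ hM]
  refine integral_congr_ae ?_
  filter_upwards [hXZ] with ω ⟨h1, h2⟩
  rw [imAtHit_eq_hitVal hFU hF h1, pathVal_eq (isClosed_absorbing hF) hM
    (im_le_of_mem_absorbing hM hFM) (hX.cont ω)]
  exact congrArg (hitVal (absorbing F)) (funext fun u => (h2 u).symm)

lemma hasHcap_iff (hΛ : IsBMLaw Λ) (hFU : F ⊆ UH) (hF : closure F ∩ UH = F)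
    (hM : 0 ≤ M) (hFM : ∀ z ∈ F, z.im ≤ M) (a : ℝ) :
    HasHcap BM F a ↔
      Tendsto (fun y : ℝ => (y - M) * height Λ (absorbing F) M (y * Complex.I)) atTop (𝓝 a) := by
  simp only [HasHcap, integral_imAtHit BM hΛ hFU hF hM hFM]
  have h1 : Tendsto (fun y : ℝ => (y - M) / y) atTop (𝓝 1) := by
    have h2 : Tendsto (fun y : ℝ => 1 - M / y) atTop (𝓝 (1 - 0)) :=
      tendsto_const_nhds.sub (tendsto_const_nhds.div_atTop tendsto_id)
    rw [sub_zero] at h2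
    refine h2.congr' ?_
    filter_upwards [eventually_gt_atTop 0] with y hy
    field_simp
  constructor <;> intro h
  · have h2 := h1.mul h
    rw [one_mul] at h2
    refine h2.congr' ?_
    filter_upwards [eventually_gt_atTop 0] with y hy
    field_simp
  · have h2 := (h1.inv₀ one_ne_zero).mul h
    rw [inv_one, one_mul] at h2
    refine h2.congr' ?_
    filter_upwards [eventually_gt_atTop 0, eventually_gt_atTop M] with y hy hyM
    have : y - M ≠ 0 := (sub_pos.2 hyM).ne'
    field_simp

/-- Existence and comparison of half-plane capacities, with a quantitative gap. -/
lemma exists_hasHcap (hΛ : IsBMLaw Λ) (hFU : F ⊆ UH) (hF : closure F ∩ UH = F)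
    (hFU' : F' ⊆ UH) (hF' : closure F' ∩ UH = F') (hsub : F ⊆ F')
    (hM : 0 ≤ M) (hFM : ∀ z ∈ F', z.im ≤ M) {c : ℝ} (hc : HasHcap BM F' c) :
    ∃ a, HasHcap BM F a ∧ ∀ y : ℝ, M < y →
      (y - M) * (height Λ (absorbing F') M (y * Complex.I) -
        height Λ (absorbing F) M (y * Complex.I)) ≤ c - a := by
  have hFM0 : ∀ z ∈ F, z.im ≤ M := fun z hz => hFM z (hsub hz)
  have hA := isClosed_absorbing hF
  have hA' := isClosed_absorbing hF'
  have hAM := im_le_of_mem_absorbing hM hFM0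
  have hAM' := im_le_of_mem_absorbing hM hFM
  have hmono : ∀ z : ℂ, 0 ≤ z.im → height Λ (absorbing F) M z ≤ height Λ (absorbing F') M z :=
    fun z hz => by
      obtain ⟨X, hX, -⟩ := exists_isBM BM z
      exact hX.height_mono hΛ hA hA' (Set.union_subset_union_left _ hsub)
        Set.subset_union_right hM hAM' hz
  have hpoisson : ∀ B : Set ℂ, IsClosed B → (∀ z ∈ B, z.im ≤ M) → ∀ y (hy : M < y),
      height Λ B M (y * Complex.I) = ∫ s : ℝ, height Λ B M (s + M * Complex.I)
        ∂ProbabilityTheory.cauchyMeasure 0 (y - M).toNNReal := fun B hB hBM y hy => by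
    obtain ⟨X, hX, -⟩ := exists_isBM BM (y * Complex.I)
    refine hX.height_eq_integral_cauchyMeasure hΛ hB hM hBM ?_ ?_ ?_
    · simpa using hy
    · rw [Real.coe_toNNReal _ (sub_nonneg.2 hy.le)]
      simp
    · simp
  have hmeas : ∀ B, Measurable fun s : ℝ => height Λ B M (s + M * Complex.I) := fun B =>
    (measurable_height Λ B M).comp (by fun_prop)
  have hscale : ∀ {k : ℝ → ℝ}, Measurable k → (∀ s, 0 ≤ k s) → (∀ s, k s ≤ M) →
      MonotoneOn (fun y => (y - M) *
        ∫ s, k s ∂ProbabilityTheory.cauchyMeasure 0 (y - M).toNNReal) (Set.Ioi M) := by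
    intro k hk hk0 hkM y hy y' hy' hyy'
    have h1 := mul_integral_cauchyMeasure_mono hk hk0 hkM
      (γ := (y - M).toNNReal) (γ' := (y' - M).toNNReal)
      (by simpa using hy) (Real.toNNReal_le_toNNReal (by linarith))
    rwa [Real.coe_toNNReal _ (sub_nonneg.2 (le_of_lt hy)),
      Real.coe_toNNReal _ (sub_nonneg.2 (le_of_lt hy'))] at h1
  have him : ∀ s : ℝ, 0 ≤ ((s : ℂ) + M * Complex.I).im := fun s => by simpa using hM
  obtain ⟨a, ha, hgap⟩ := exists_tendsto_of_monotone_sub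
    (f := fun y => (y - M) * height Λ (absorbing F) M (y * Complex.I)) (M := M)
    (fun y hy y' hy' hyy' => by
      have := hscale (hmeas (absorbing F)) (fun s => height_nonneg _ _ _ _)
        (fun s => height_le _ _ hM _) hy hy' hyy'
      simpa only [hpoisson _ hA hAM y hy, hpoisson _ hA hAM y' hy'] using this)
    (fun y hy y' hy' hyy' => by
      have := hscale ((hmeas (absorbing F')).sub (hmeas (absorbing F)))
        (fun s => sub_nonneg.2 (hmono _ (him s)))
        (fun s => (sub_le_self _ (height_nonneg _ _ _ _)).trans (height_le _ _ hM _)) hy hy' hyy'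
      have hi : ∀ B (γ : ℝ≥0), Integrable (fun s : ℝ => height Λ B M (s + M * Complex.I))
          (ProbabilityTheory.cauchyMeasure 0 γ) := fun B γ =>
        Integrable.of_bound (hmeas B).aestronglyMeasurable M (Eventually.of_forall fun s => by
          rw [Real.norm_of_nonneg (height_nonneg _ _ _ _)]
          exact height_le _ _ hM _)
      simpa only [Pi.sub_apply, integral_sub (hi _ _) (hi _ _), mul_sub, ← hpoisson _ hA hAM y hy,
        ← hpoisson _ hA hAM y' hy', ← hpoisson _ hA' hAM' y hy,
        ← hpoisson _ hA' hAM' y' hy'] using this)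
    (fun y hy => mul_le_mul_of_nonneg_left
      (hmono _ (by simpa using hM.trans hy.le)) (sub_nonneg.2 hy.le))
    ((hasHcap_iff BM hΛ hFU' hF' hM hFM c).1 hc)
  refine ⟨a, (hasHcap_iff BM hΛ hFU hF hM hFM0 a).2 ha, fun y hy => ?_⟩
  rw [mul_sub]
  exact hgap y hy

end

/-! ### Brownian motion follows any given path with positive probability -/

instance isOpenPosMeasure_gam_one : (gam 1).IsOpenPosMeasure := by
  have h1 : (ProbabilityTheory.gaussianReal 0 1).IsOpenPosMeasure :=
    (ProbabilityTheory.gaussianReal_absolutelyContinuous' 0 one_ne_zero).isOpenPosMeasure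
  refine ⟨fun U hU hne => ?_⟩
  rw [gam, Measure.map_apply measurable_equivRealProd_symm hU.measurableSet]
  refine (hU.preimage Complex.equivRealProdCLM.symm.continuous).measure_ne_zero _ ?_
  obtain ⟨u, hu⟩ := hne
  exact ⟨Complex.equivRealProd u, by
    exact hu⟩

lemma gam_map_mul (c v : ℝ≥0) : (gam v).map (fun w => (c : ℂ) * w) = gam (c ^ 2 * v) := by
  have h1 := ProbabilityTheory.gaussianReal_map_const_mul (μ := 0) (v := v) (c : ℝ)
  have hv : NNReal.mk ((c : ℝ) ^ 2) (sq_nonneg _) * v = c ^ 2 * v := by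
    ext
    simp
  rw [hv, mul_zero] at h1
  rw [gam, gam, Measure.map_map (by fun_prop) measurable_equivRealProd_symm, ← h1,
    Measure.map_prod_map _ _ (by fun_prop) (by fun_prop),
    Measure.map_map measurable_equivRealProd_symm (by fun_prop)]
  congr 1
  ext p
  apply Complex.ext <;> simp [Complex.equivRealProd]

section
variable {Ω : Type*} [MeasurableSpace Ω] {P : Measure Ω} {X : Ω → ℝ≥0 → ℂ} {z : ℂ}

/-- Brownian scaling. -/
lemma IsBM.scale (h : IsBM P X z) (x : ℂ) {c : ℝ≥0} (hc : c ≠ 0) :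
    IsBM P (fun ω u => x + c * X ω (u / c ^ 2)) (x + c * z) where
  prob := h.prob
  meas := measurable_pi_lambda _ fun u =>
    ((h.measurable_eval _).const_mul _).const_add _
  cont ω := by
    have := h.cont ω
    have h2 : Continuous fun u : ℝ≥0 => u / c ^ 2 := by
      simp only [div_eq_mul_inv]
      fun_prop
    exact continuous_const.add (continuous_const.mul (this.comp h2))
  start ω := by simp [h.start]
  indep s t hst := by
    have := h.prob
    have hc2 : (0 : ℝ≥0) < c ^ 2 := by positivity
    have h1 := h.indep (s / c ^ 2) (t / c ^ 2) (by gcongr)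
    set f : (ℝ≥0 → ℂ) → ℝ≥0 → ℂ := fun w u => x + c * w (u / c ^ 2) with hf
    have hfm : Measurable f := measurable_pi_lambda _ fun u =>
      ((measurable_pi_apply _).const_mul _).const_add _
    have hgm : Measurable fun w : ℂ => (c : ℂ) * w := by fun_prop
    have hst1 : ∀ ω, stopAt s (fun u => x + c * X ω (u / c ^ 2)) = f (stopAt (s / c ^ 2) (X ω)) :=
      fun ω => by
        ext u
        simp only [stopAt, hf]
        rw [min_div_div_right hc2.le]
    have hm : Measurable fun ω => stopAt (s / c ^ 2) (X ω) :=
      (measurable_pi_lambda _ fun u => measurable_pi_apply _ :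
        Measurable (stopAt (s / c ^ 2))).comp h.meas
    have hmi : Measurable fun ω => X ω (t / c ^ 2) - X ω (s / c ^ 2) :=
      (h.measurable_eval _).sub (h.measurable_eval _)
    have h2 : (gam (t / c ^ 2 - s / c ^ 2)).map (fun w => (c : ℂ) * w) = gam (t - s) := by
      rw [gam_map_mul, mul_tsub, mul_div_cancel₀ _ hc2.ne', mul_div_cancel₀ _ hc2.ne']
    have h3 := congrArg (Measure.map (Prod.map f fun w : ℂ => (c : ℂ) * w)) h1
    rw [Measure.map_map (hfm.prodMap hgm) (hm.prodMk hmi),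
      ← Measure.map_prod_map _ _ hfm hgm, h2, Measure.map_map hfm hm] at h3
    simp only [hst1]
    refine Eq.trans ?_ h3
    congr 1
    ext ω : 1
    simp only [Function.comp_apply, Prod.map_apply]
    congr 1
    ring

/-- The indicator that a path avoids `A` up to time `δ` and is in `C` at time `δ`. -/
noncomputable def stepVal (A : Set ℂ) (δ : ℝ≥0) (C : Set ℂ) : (ℝ≥0 → ℂ) → ℝ :=
  {w | ¬ HitBy A w δ ∧ w δ ∈ C}.indicator 1

lemma measurable_stepVal (A : Set ℂ) (δ : ℝ≥0) {C : Set ℂ} (hC : MeasurableSet C) :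
    Measurable (stepVal A δ C) :=
  measurable_one.indicator ((measurableSet_hitBy_path A δ).compl.inter
    (measurable_pi_apply δ hC))

lemma stepVal_nonneg (A : Set ℂ) (δ : ℝ≥0) (C : Set ℂ) (w : ℝ≥0 → ℂ) : 0 ≤ stepVal A δ C w :=
  Set.indicator_nonneg (fun _ _ => zero_le_one) w

lemma stepVal_le (A : Set ℂ) (δ : ℝ≥0) (C : Set ℂ) (w : ℝ≥0 → ℂ) : stepVal A δ C w ≤ 1 :=
  Set.indicator_le_self' (fun _ _ => zero_le_one) w

variable {Λ : Measure (ℝ≥0 → ℂ)} [IsProbabilityMeasure Λ]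

lemma IsBM.avg_stepVal (h : IsBM P X z) (hΛ : IsBMLaw Λ) {A : Set ℂ} (hA : IsClosed A) (δ : ℝ≥0)
    {C : Set ℂ} (hC : MeasurableSet C) :
    avg Λ (stepVal A δ C) z = P.real ((hitSet A X δ)ᶜ ∩ {ω | X ω δ ∈ C}) := by
  have hm : MeasurableSet ((hitSet A X δ)ᶜ ∩ {ω | X ω δ ∈ C}) :=
    (h.measurableSet_hitSet hA δ).compl.inter (h.measurable_eval δ hC)
  rw [← h.integral_eq_avg hΛ (measurable_stepVal A δ hC) (stepVal_nonneg A δ C)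
    (stepVal_le A δ C), ← integral_indicator_one hm]
  congr 1
  ext ω
  have h1 : HitBy A (X ω) δ ↔ ω ∈ hitSet A X δ := hitBy_iff hA (h.cont ω)
  by_cases hω : ω ∈ (hitSet A X δ)ᶜ ∩ {ω | X ω δ ∈ C}
  · rw [Set.indicator_of_mem hω, stepVal, Set.indicator_of_mem]
    · rfl
    · exact ⟨fun h2 => hω.1 (h1.1 h2), hω.2⟩
  · rw [Set.indicator_of_notMem hω, stepVal, Set.indicator_of_notMem]
    exact fun h2 => hω ⟨fun h3 => h2.1 (h1.2 h3), h2.2⟩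

lemma IsBM.exists_tube_event (h : IsBM P X z) (hΛ : IsBMLaw Λ) {v : ℕ → ℂ} {ρ η : ℝ} {δ : ℝ≥0}
    (hstep : ∀ n x, x ∈ Metric.ball (v n) η →
      0 < avg Λ (stepVal (Metric.ball (v n) ρ)ᶜ δ (Metric.ball (v (n + 1)) η)) x)
    (hz : z ∈ Metric.ball (v 0) η) (n : ℕ) :
    ∃ E, MeasurableSet[past X (n * δ)] E ∧ P E ≠ 0 ∧ ∀ ω ∈ E,
      X ω (n * δ) ∈ Metric.ball (v n) η ∧
        ∀ k < n, ∀ r ≤ δ, X ω (k * δ + r) ∈ Metric.ball (v k) ρ := by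
  have := h.prob
  induction n with
  | zero =>
    refine ⟨Set.univ, @MeasurableSet.univ _ (past X _), by simp, fun ω _ => ⟨?_, by simp⟩⟩
    simpa [h.start] using hz
  | succ n ih =>
    obtain ⟨E, hE, hPE, hEω⟩ := ih
    set A := (Metric.ball (v n) ρ)ᶜ with hAdef
    have hA : IsClosed A := Metric.isOpen_ball.isClosed_compl
    set C := Metric.ball (v (n + 1)) η with hCdef
    have hC : MeasurableSet C := measurableSet_ball
    set S : Set Ω := {ω | ¬ HitBy A (fun u => X ω (n * δ + u)) δ ∧ X ω (n * δ + δ) ∈ C} with hS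
    have hsucc : ((n + 1 : ℕ) : ℝ≥0) * δ = n * δ + δ := by push_cast; ring
    have hSm : MeasurableSet[past X ((n + 1 : ℕ) * δ)] S := by
      rw [hsucc]
      refine @MeasurableSet.inter _ (past X (n * δ + δ)) _ _
        (@MeasurableSet.compl _ _ (past X (n * δ + δ)) (@measurableSet_hitBy Ω
          (past X (n * δ + δ)) A (fun u ω => X ω (n * δ + u)) δ fun u hu =>
            measurable_past X (by gcongr)))
        (measurable_past X le_rfl hC)
    have hEm : MeasurableSet E := h.past_le _ _ hE
    refine ⟨E ∩ S, @MeasurableSet.inter _ (past X ((n + 1 : ℕ) * δ)) _ _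
      (past_mono X (by gcongr; simp) _ hE) hSm, ?_, ?_⟩
    · have hSm' : MeasurableSet S := h.past_le _ _ hSm
      have h1 := h.setIntegral_shift hΛ (measurable_stepVal A δ hC) (stepVal_nonneg A δ C)
        (stepVal_le A δ C) hE
      have h2 : ∫ ω in E, stepVal A δ C (fun u => X ω (n * δ + u)) ∂P = P.real (E ∩ S) := by
        have h3 : (fun ω => stepVal A δ C (fun u => X ω (n * δ + u))) = S.indicator 1 := by
          ext ω
          simp only [stepVal, Set.indicator]
          rfl
        rw [h3, setIntegral_indicator hSm']
        simp
      have h4 : 0 < ∫ ω in E, avg Λ (stepVal A δ C) (X ω (n * δ)) ∂P := by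
        have hi : Integrable (fun ω => avg Λ (stepVal A δ C) (X ω (n * δ))) P :=
          Integrable.of_bound ((measurable_avg (measurable_stepVal A δ hC)).comp
            (h.measurable_eval _)).aestronglyMeasurable 1 (Eventually.of_forall fun ω => by
              rw [Real.norm_of_nonneg (avg_nonneg (stepVal_nonneg A δ C) _)]
              exact avg_le (measurable_stepVal A δ hC) (stepVal_nonneg A δ C) (stepVal_le A δ C) _)
        rw [setIntegral_pos_iff_support_of_nonneg_ae
          (Eventually.of_forall fun ω => avg_nonneg (stepVal_nonneg A δ C) _) hi.integrableOn]
        refine lt_of_lt_of_le (pos_iff_ne_zero.2 hPE) (measure_mono fun ω hω => ⟨?_, hω⟩)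
        exact (hstep n _ (hEω ω hω).1).ne'
      rw [← h1, h2] at h4
      exact fun h5 => h4.ne' (by simp [Measure.real, h5])
    · rintro ω ⟨hωE, hω1, hω2⟩
      refine ⟨by rwa [hsucc], fun k hk r hr => ?_⟩
      rcases Nat.lt_succ_iff_lt_or_eq.1 hk with hk | rfl
      · exact (hEω ω hωE).2 k hk r hr
      · by_contra hr'
        have hc : Continuous fun u => X ω (k * δ + u) :=
          (h.cont ω).comp (continuous_const.add continuous_id)
        exact hω1 ((hitBy_iff hA hc).2 ⟨r, hr, hr'⟩)

lemma IsBM.exists_radius (h : IsBM P X 0) : ∃ R : ℝ, 0 < R ∧ ∀ v : ℂ, ‖v‖ ≤ 2 →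
    P ((hitSet (Metric.ball 0 R)ᶜ X 1)ᶜ ∩ {ω | X ω 1 ∈ Metric.ball v 1}) ≠ 0 := by
  have := h.prob
  obtain ⟨t, -, ht, hcover⟩ := Metric.finite_approx_of_totallyBounded
    (isCompact_closedBall (0 : ℂ) 2).totallyBounded (1 / 2) (by norm_num)
  have h1 : ∀ y ∈ t, ∀ᶠ R : ℕ in atTop, P ((hitSet (Metric.ball 0 (R : ℝ))ᶜ X 1)ᶜ ∩
      {ω | X ω 1 ∈ Metric.ball y (1 / 2)}) ≠ 0 := fun y _ => by
    have h2 : P {ω | X ω 1 ∈ Metric.ball y (1 / 2)} ≠ 0 := by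
      have h3 : {ω | X ω 1 ∈ Metric.ball y (1 / 2)} =
        (fun ω => X ω 1) ⁻¹' Metric.ball y (1 / 2) := rfl
      rw [h3, ← Measure.map_apply (h.measurable_eval 1) measurableSet_ball, h.map_eval,
        Measure.map_apply (by fun_prop) measurableSet_ball]
      refine (Metric.isOpen_ball.preimage (by fun_prop)).measure_ne_zero _ ⟨y, ?_⟩
      simp
    have hsub : {ω | X ω 1 ∈ Metric.ball y (1 / 2)} ⊆ ⋃ R : ℕ,
        ((hitSet (Metric.ball 0 (R : ℝ))ᶜ X 1)ᶜ ∩ {ω | X ω 1 ∈ Metric.ball y (1 / 2)}) :=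
      fun ω hω => by
        obtain ⟨K, hK⟩ := ((isCompact_Icc (a := (0 : ℝ≥0)) (b := 1)).image
          (h.cont ω)).isBounded.subset_ball 0
        obtain ⟨R, hR⟩ := exists_nat_ge K
        refine Set.mem_iUnion.2 ⟨R, ?_, hω⟩
        rintro ⟨r, hr, hr'⟩
        exact hr' (Metric.ball_subset_ball hR (hK ⟨r, ⟨zero_le, hr⟩, rfl⟩))
    have h4 : ∃ R : ℕ, P ((hitSet (Metric.ball 0 (R : ℝ))ᶜ X 1)ᶜ ∩
        {ω | X ω 1 ∈ Metric.ball y (1 / 2)}) ≠ 0 := by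
      by_contra! h5
      exact h2 (measure_mono_null hsub (measure_iUnion_null h5))
    obtain ⟨R, hR⟩ := h4
    filter_upwards [eventually_ge_atTop R] with R' hR' h0
    refine hR (measure_mono_null (Set.inter_subset_inter_left _ ?_) h0)
    refine Set.compl_subset_compl.2 ?_
    rintro ω ⟨r, hr, hr'⟩
    refine ⟨r, hr, fun h6 => hr' (Metric.ball_subset_ball ?_ h6)⟩
    exact_mod_cast hR'
  obtain ⟨R, hR, hR0⟩ := (((Set.Finite.eventually_all ht).2 h1).and (eventually_gt_atTop 0)).exists
  refine ⟨R, by exact_mod_cast hR0, fun v hv h0 => ?_⟩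
  obtain ⟨y, hy, hvy⟩ := Set.mem_iUnion₂.1 (hcover (mem_closedBall_zero_iff.2 hv))
  refine hR y hy (measure_mono_null (Set.inter_subset_inter_right _ fun ω hω => ?_) h0)
  refine Metric.ball_subset_ball' ?_ hω
  rw [Metric.mem_ball, dist_comm] at hvy
  linarith

lemma IsBM.exists_step (h : IsBM P X 0) (hΛ : IsBMLaw Λ) {ρ : ℝ} (hρ : 0 < ρ) :
    ∃ η : ℝ, 0 < η ∧ ∃ δ : ℝ≥0, 0 < δ ∧ ∀ v v' x : ℂ, dist v' v ≤ η →
      x ∈ Metric.ball v η → 0 < avg Λ (stepVal (Metric.ball v ρ)ᶜ δ (Metric.ball v' η)) x := by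
  obtain ⟨R, hR0, hR⟩ := h.exists_radius
  have hη : 0 < ρ / (R + 1) := by positivity
  set c : ℝ≥0 := ⟨ρ / (R + 1), hη.le⟩ with hc
  have hc0 : c ≠ 0 := fun h0 => hη.ne' (congrArg NNReal.toReal h0)
  have hcR : (c : ℝ) * (R + 1) = ρ := by
    change ρ / (R + 1) * (R + 1) = ρ
    field_simp
  have hcp : (0 : ℝ) < c := hη
  refine ⟨c, hη, c ^ 2, by positivity, fun v v' x hvv' hx => ?_⟩
  have hs := h.scale x hc0
  rw [mul_zero, add_zero] at hs
  have := hs.prob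
  rw [hs.avg_stepVal hΛ Metric.isOpen_ball.isClosed_compl _ measurableSet_ball, measureReal_def,
    ENNReal.toReal_pos_iff]
  refine ⟨pos_iff_ne_zero.2 fun h0 => ?_, measure_lt_top _ _⟩
  have hcC : (c : ℂ) ≠ 0 := by exact_mod_cast hc0
  have hnc : ‖(c : ℂ)‖ = c := by simp
  refine hR ((v' - x) / c) ?_ (measure_mono_null ?_ h0)
  · rw [norm_div, div_le_iff₀ (by simpa using hcp), hnc, ← dist_eq_norm]
    have := dist_triangle v' v x
    rw [Metric.mem_ball, dist_comm] at hx
    linarith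
  · rintro ω ⟨h1, h2⟩
    constructor
    · rintro ⟨r, hr, hr'⟩
      have hr1 : r / c ^ 2 ≤ 1 := div_le_one_of_le₀ hr zero_le
      have h3 : X ω (r / c ^ 2) ∈ Metric.ball 0 R := by
        by_contra h4
        exact h1 ⟨_, hr1, h4⟩
      refine hr' ?_
      rw [mem_ball_zero_iff] at h3
      rw [Metric.mem_ball] at hx ⊢
      have h5 : dist (x + c * X ω (r / c ^ 2)) x < c * R := by
        rw [dist_eq_norm, add_sub_cancel_left, norm_mul, hnc]
        gcongr
      linarith [dist_triangle (x + c * X ω (r / c ^ 2)) x v]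
    · have h3 : dist (X ω 1) ((v' - x) / c) < 1 := h2
      change dist (x + c * X ω (c ^ 2 / c ^ 2)) v' < c
      rw [div_self (by positivity)]
      have h4 : x + c * X ω 1 - v' = c * (X ω 1 - (v' - x) / c) := by
        field_simp
        ring
      rw [dist_eq_norm, h4, norm_mul, hnc, ← dist_eq_norm]
      nlinarith

/-- Brownian motion stays, with positive probability, close to a given continuous path. -/
lemma IsBM.exists_follow {Ω' : Type*} [MeasurableSpace Ω'] {P' : Measure Ω'} {X' : Ω' → ℝ≥0 → ℂ}
    (h' : IsBM P' X' 0) (h : IsBM P X z) {γ : ℝ → ℂ} (hγ : ContinuousOn γ (Set.Icc 0 1))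
    (hz : γ 0 = z) {ε : ℝ} (hε : 0 < ε) :
    ∃ t : ℝ≥0, P {ω | ∀ s : ℝ≥0, s ≤ 1 → dist (X ω (s * t)) (γ s) < ε} ≠ 0 := by
  obtain ⟨Λ, hΛp, hΛ⟩ := h'.exists_law
  obtain ⟨η, hη, δ, hδ, hstep⟩ := h'.exists_step hΛ (ρ := ε / 2) (half_pos hε)
  have huc := isCompact_Icc.uniformContinuousOn_of_continuous hγ
  obtain ⟨d, hd, hdγ⟩ := Metric.uniformContinuousOn_iff.1 huc (min η (ε / 2))
    (lt_min hη (half_pos hε))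
  obtain ⟨N, hN⟩ := exists_nat_one_div_lt hd
  set K : ℝ := N + 1 with hK
  have hK0 : 0 < K := by positivity
  set p : ℕ → ℝ := fun k => min (k / K) 1 with hp
  have hp0 : ∀ k, p k ∈ Set.Icc (0 : ℝ) 1 := fun k =>
    ⟨le_min (by positivity) zero_le_one, min_le_right _ _⟩
  have hpd : ∀ k, dist (p (k + 1)) (p k) < d := fun k => by
    refine lt_of_le_of_lt ?_ hN
    have h1 : dist (p (k + 1)) (p k) ≤ |((k + 1 : ℕ) : ℝ) / K - k / K| := by
      rw [Real.dist_eq]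
      simpa [hp] using abs_min_sub_min_le_max (((k + 1 : ℕ) : ℝ) / K) 1 (k / K) 1
    refine h1.trans ?_
    rw [← sub_div]
    push_cast
    rw [add_sub_cancel_left, abs_of_pos (by positivity)]
  obtain ⟨E, -, hPE, hE⟩ := h.exists_tube_event hΛ (v := fun k => γ (p k)) (ρ := ε / 2) (η := η)
    (δ := δ) (fun n x hx => hstep _ _ x
      ((hdγ _ (hp0 _) _ (hp0 _) (hpd n)).le.trans (min_le_left _ _)) hx)
    (by simp [hp, hz, hη]) (N + 1)
  refine ⟨(N + 1 : ℕ) * δ, fun h0 => hPE (measure_mono_null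
    (t := {ω | ∀ s : ℝ≥0, s ≤ 1 → dist (X ω (s * ((N + 1 : ℕ) * δ))) (γ s) < ε})
    (fun ω hω s hs => ?_) h0)⟩
  set k : ℕ := min ⌊s * (N + 1 : ℕ)⌋₊ N with hk
  have hkN : k ≤ N := min_le_right _ _
  have h1 : (k : ℝ≥0) ≤ s * (N + 1 : ℕ) :=
    (Nat.cast_le.2 (min_le_left _ _)).trans (Nat.floor_le zero_le)
  have h2 : s * (N + 1 : ℕ) ≤ k + 1 := by
    rcases min_choice ⌊s * (N + 1 : ℕ)⌋₊ N with h3 | h3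
    · rw [hk, h3]
      exact (Nat.lt_floor_add_one _).le
    · rw [hk, h3]
      calc s * (N + 1 : ℕ) ≤ 1 * (N + 1 : ℕ) := by gcongr
        _ = _ := by push_cast; ring
  obtain ⟨e, he⟩ := exists_add_of_le h1
  have he1 : e ≤ 1 := by
    rw [he] at h2
    exact le_of_add_le_add_left h2
  have h3 := (hE ω hω).2 k (Nat.lt_succ_of_le hkN) (e * δ) (mul_le_of_le_one_left zero_le he1)
  rw [← add_mul, ← he, mul_assoc] at h3
  have heR : (s : ℝ) * K = k + e := by
    have := congrArg NNReal.toReal he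
    push_cast at this
    exact this
  have hpk : p k = k / K := by
    refine min_eq_left ((div_le_one hK0).2 ?_)
    have : (k : ℝ) ≤ N := by exact_mod_cast hkN
    linarith
  have hsd : dist (s : ℝ) (p k) < d := by
    refine lt_of_le_of_lt ?_ hN
    have h4 : (s : ℝ) - k / K = e / K := by
      field_simp
      linarith
    have h5 : (e : ℝ) ≤ 1 := by exact_mod_cast he1
    rw [hpk, Real.dist_eq, h4, abs_of_nonneg (by positivity)]
    gcongr
  have h6 := (hdγ s ⟨s.2, by exact_mod_cast hs⟩ _ (hp0 k) hsd).trans_le (min_le_right _ _)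
  rw [Metric.mem_ball] at h3
  rw [dist_comm] at h6
  linarith [dist_triangle (X ω (s * ((N + 1 : ℕ) * δ))) (γ (p k)) (γ s)]

end

/-! ### Loops around a boundary point of a simply connected domain -/

lemma eq_of_exp_eq_one {α : Type*} [TopologicalSpace α] {S : Set α} (hS : IsPreconnected S)
    {f : α → ℂ} (hf : ContinuousOn f S) (h1 : ∀ x ∈ S, Complex.exp (f x) = 1) {x y : α}
    (hx : x ∈ S) (hy : y ∈ S) : f x = f y := by
  have h2 : ∀ x, ∃ n : ℤ, x ∈ S → f x = n * (2 * Real.pi * Complex.I) := fun x => by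
    by_cases hx : x ∈ S
    · obtain ⟨n, hn⟩ := Complex.exp_eq_one_iff.1 (h1 x hx)
      exact ⟨n, fun _ => hn⟩
    · exact ⟨0, fun h => absurd h hx⟩
  choose n hn using h2
  have hc : ContinuousOn n S := by
    rw [Int.isClosedEmbedding_coe_real.isInducing.continuousOn_iff]
    have h3 : ContinuousOn (fun x => (f x).im / (2 * Real.pi)) S :=
      (Complex.continuous_im.comp_continuousOn hf).div_const _
    refine h3.congr fun x hx => ?_
    simp only [Function.comp_apply]
    rw [hn x hx]
    have := Real.pi_pos.ne'
    simp
  rw [hn x hx, hn y hy, (hS.image n hc).subsingleton ⟨x, hx, rfl⟩ ⟨y, hy, rfl⟩]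

lemma div_mem_slitPlane {a b z₀ : ℂ} {ε : ℝ} (hab : dist a b < ε) (hb : ε ≤ dist b z₀) :
    (a - z₀) / (b - z₀) ∈ Complex.slitPlane := by
  have hb0 : 0 < dist b z₀ := (dist_nonneg.trans_lt hab).trans_le hb
  have hne : b - z₀ ≠ 0 := sub_ne_zero.2 (dist_pos.1 hb0)
  have h1 : (a - z₀) / (b - z₀) = 1 + (a - b) / (b - z₀) := by
    field_simp
    ring
  rw [h1]
  refine Complex.mem_slitPlane_of_norm_lt_one ?_
  rw [norm_div, div_lt_one (by rwa [← dist_eq_norm]), ← dist_eq_norm, ← dist_eq_norm]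
  exact hab.trans_le hb

lemma exists_loop {D U : Set ℂ} (hD : IsOpen D) (hDs : IsSimplyConnected D) (hU : IsOpen U)
    (hDU : D ⊆ U) {z₀ p : ℂ} (hz₀ : z₀ ∉ D) (hz₀U : z₀ ∈ U) (hz₀c : z₀ ∈ closure D) (hp : p ∈ D)
    {ε₀ : ℝ} (hε₀ : 0 < ε₀) :
    ∃ γ : ℝ → ℂ, ContinuousOn γ (Set.Icc 0 1) ∧ γ 0 = p ∧ γ 1 = p ∧ ∃ ε, 0 < ε ∧ ε ≤ ε₀ ∧
      ∀ g : ℝ → ℂ, ContinuousOn g (Set.Icc 0 1) → g 0 = p →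
        (∀ s ∈ Set.Icc (0 : ℝ) 1, dist (g s) (γ s) < ε) →
        (∀ s ∈ Set.Icc (0 : ℝ) 1, g s ∈ U) ∧ ∃ s ∈ Set.Icc (0 : ℝ) 1, g s ∉ D := by
  obtain ⟨r, hr, hrU⟩ := Metric.isOpen_iff.1 hU z₀ hz₀U
  obtain ⟨z₁, hz₁, hz₁r⟩ := Metric.mem_closure_iff.1 hz₀c r hr
  have hpc : IsPathConnected D := by
    have : SimplyConnectedSpace D := hDs
    exact isPathConnected_iff_pathConnectedSpace.2 inferInstance
  have hj := hpc.joinedIn p hp z₁ hz₁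
  set q : ℝ → ℂ := fun s => hj.somePath.extend s with hq
  have hqc : Continuous q := hj.somePath.extend.continuous
  have hqD : ∀ s, q s ∈ D := fun s => hj.somePath_mem _
  have hq0 : q 0 = p := hj.somePath.extend_zero
  have hq1 : ∀ s, 1 ≤ s → q s = z₁ := fun s hs => hj.somePath.extend_of_one_le hs
  have hq0' : ∀ s, s ≤ 0 → q s = p := fun s hs => hj.somePath.extend_of_le_zero hs
  obtain ⟨L, hLc, hL⟩ := Complex.exists_continuousOn_eqOn_exp_comp hDs hD (g := fun z => z - z₀)
    (by fun_prop) (by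
      rintro ⟨z, hz, h0⟩
      exact hz₀ (sub_eq_zero.1 h0 ▸ hz))
  have hL' : ∀ z ∈ D, Complex.exp (L z) = z - z₀ := fun z hz => hL hz
  set θ : ℝ → ℝ := fun s => max 0 (min 1 (3 * s - 1)) with hθ
  set τ : ℝ → ℝ := fun s => min (3 * s) (3 - 3 * s) with hτ
  have hθc : Continuous θ := by fun_prop
  have hτc : Continuous τ := by fun_prop
  set lam : ℝ → ℂ := fun s => L (q (τ s)) + θ s * (2 * Real.pi * Complex.I) with hlam
  have hlamc : Continuous lam :=
    (hLc.comp_continuous (hqc.comp hτc) fun s => hqD _).add (by fun_prop)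
  set γ : ℝ → ℂ := fun s => z₀ + Complex.exp (lam s) with hγ
  have hγc : Continuous γ := by fun_prop
  have hγe : ∀ s, γ s - z₀ = Complex.exp (lam s) := fun s => by simp [hγ]
  have hγD : ∀ s, (θ s = 0 ∨ θ s = 1) → γ s = q (τ s) := fun s hs => by
    have h1 : Complex.exp (θ s * (2 * Real.pi * Complex.I)) = 1 := by
      rcases hs with hs | hs <;> simp [hs]
    simp only [hγ, hlam]
    rw [Complex.exp_add, h1, mul_one, hL' _ (hqD _)]
    ring
  have hγU : ∀ s, γ s ∈ U := fun s => by
    rcases le_total (3 * s) 1 with h1 | h1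
    · have h2 : θ s = 0 := max_eq_left ((min_le_right _ _).trans (by linarith))
      rw [hγD s (Or.inl h2)]
      exact hDU (hqD _)
    rcases le_total 2 (3 * s) with h2 | h2
    · have h3 : θ s = 1 := by
        simp only [hθ]
        rw [min_eq_left (by linarith), max_eq_right zero_le_one]
      rw [hγD s (Or.inr h3)]
      exact hDU (hqD _)
    · refine hrU ?_
      have h3 : q (τ s) = z₁ := hq1 _ (le_min h1 (by linarith))
      rw [Metric.mem_ball, dist_eq_norm, hγe]
      simp only [hlam]
      rw [Complex.exp_add, h3, hL' _ hz₁, norm_mul, Complex.norm_exp]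
      rw [dist_comm, dist_eq_norm] at hz₁r
      simpa using hz₁r
  have hγ0 : γ 0 = p := by
    have h1 : θ 0 = 0 := max_eq_left ((min_le_right _ _).trans (by norm_num))
    rw [hγD 0 (Or.inl h1)]
    exact hq0' _ ((min_le_left _ _).trans (by norm_num))
  have hγ1 : γ 1 = p := by
    have h1 : θ 1 = 1 := by
      simp only [hθ]
      norm_num
    rw [hγD 1 (Or.inr h1)]
    exact hq0' _ ((min_le_right _ _).trans (by norm_num))
  obtain ⟨ε₁, hε₁, hthick⟩ := (isCompact_Icc.image hγc :
    IsCompact (γ '' Set.Icc 0 1)).exists_thickening_subset_open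
    (hU.sdiff isClosed_singleton : IsOpen (U \ {z₀})) (by
      rintro _ ⟨s, -, rfl⟩
      exact ⟨hγU s, fun h0 => Complex.exp_ne_zero (lam s) (by rw [← hγe, h0, sub_self])⟩)
  obtain ⟨ε₂, hε₂, hball⟩ := Metric.isOpen_iff.1 hD p hp
  set ε := min ε₀ (min ε₁ ε₂) with hε
  have hεε₁ : ε ≤ ε₁ := (min_le_right _ _).trans (min_le_left _ _)
  have hεε₂ : ε ≤ ε₂ := (min_le_right _ _).trans (min_le_right _ _)
  refine ⟨γ, hγc.continuousOn, hγ0, hγ1, ε, lt_min hε₀ (lt_min hε₁ hε₂), min_le_left _ _,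
    fun g hgc hg0 hgγ => ?_⟩
  have hnear : ∀ s ∈ Set.Icc (0 : ℝ) 1, ∀ x, dist x (γ s) < ε → x ∈ U \ {z₀} :=
    fun s hs x hx => hthick (Metric.mem_thickening_iff.2 ⟨γ s, ⟨s, hs, rfl⟩, hx.trans_le hεε₁⟩)
  have hfar : ∀ s ∈ Set.Icc (0 : ℝ) 1, ε ≤ dist (γ s) z₀ := fun s hs => by
    by_contra! h
    rw [dist_comm] at h
    exact (hnear s hs z₀ h).2 rfl
  refine ⟨fun s hs => (hnear s hs _ (hgγ s hs)).1, ?_⟩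
  by_contra! hgD
  have h0 : (0 : ℝ) ∈ Set.Icc (0 : ℝ) 1 := by simp
  have h1 : (1 : ℝ) ∈ Set.Icc (0 : ℝ) 1 := by simp
  have hpz : p - z₀ ≠ 0 := sub_ne_zero.2 fun h => hz₀ (h ▸ hp)
  have hsub : ∀ z ∈ D, z - z₀ ≠ 0 := fun z hz => sub_ne_zero.2 fun h => hz₀ (h ▸ hz)
  have e1 := eq_of_exp_eq_one (isPreconnected_Icc (a := (0 : ℝ)) (b := 1))
    (f := fun s => L (g s) - lam s - Complex.log ((g s - z₀) / (γ s - z₀)))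
    (((hLc.comp hgc hgD).sub hlamc.continuousOn).sub (ContinuousOn.clog
      ((hgc.sub continuousOn_const).div (hγc.continuousOn.sub continuousOn_const)
        fun s hs => by rw [hγe]; exact Complex.exp_ne_zero _)
      fun s hs => div_mem_slitPlane (hgγ s hs) (hfar s hs)))
    (fun s hs => by
      have h2 := Complex.exp_ne_zero (lam s)
      have h3 := hsub _ (hgD s hs)
      rw [Complex.exp_sub, Complex.exp_sub, hL' _ (hgD s hs), hγe,
        Complex.exp_log (div_ne_zero h3 h2)]
      field_simp) h0 h1
  have hdp : ∀ x ∈ Metric.ball p ε, x ∈ D := fun x hx =>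
    hball (Metric.ball_subset_ball hεε₂ hx)
  have hpfar : ε ≤ dist p z₀ := hγ0 ▸ hfar 0 h0
  have hg1 : g 1 ∈ Metric.ball p ε := by
    have := hgγ 1 h1
    rwa [hγ1] at this
  have e2 := eq_of_exp_eq_one (convex_ball p ε).isPreconnected
    (f := fun x => L x - L p - Complex.log ((x - z₀) / (p - z₀)))
    (((hLc.mono hdp).sub continuousOn_const).sub (ContinuousOn.clog
      ((continuousOn_id.sub continuousOn_const).div_const _)
      fun x hx => div_mem_slitPlane (ε := ε) hx hpfar))
    (fun x hx => by
      have h3 := hsub _ (hdp x hx)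
      rw [Complex.exp_sub, Complex.exp_sub, hL' _ (hdp x hx), hL' _ hp,
        Complex.exp_log (div_ne_zero h3 hpz)]
      field_simp) (Metric.mem_ball_self (lt_min hε₀ (lt_min hε₁ hε₂))) hg1
  have hθ0 : θ 0 = 0 := max_eq_left ((min_le_right _ _).trans (by norm_num))
  have hθ1 : θ 1 = 1 := by
    simp only [hθ]
    norm_num
  have hlam0 : lam 0 = L p := by
    simp only [hlam, hθ0]
    rw [hq0' _ ((min_le_left _ _).trans (by norm_num))]
    simp
  have hlam1 : lam 1 = L p + 2 * Real.pi * Complex.I := by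
    simp only [hlam, hθ1]
    rw [hq0' _ ((min_le_right _ _).trans (by norm_num))]
    simp
  simp only [hlam0, hlam1, hγ0, hγ1, hg0, div_self hpz, Complex.log_one, sub_self] at e1 e2
  have e3 : (2 * Real.pi * Complex.I : ℂ) = 0 := by
    linear_combination e1 - e2
  exact Complex.two_pi_I_ne_zero e3

lemma exists_mem_closure_of_ssubset {D U : Set ℂ} (hD : IsOpen D) (hU : IsPreconnected U)
    (hDU : D ⊂ U) (hne : D.Nonempty) : ∃ z ∈ U, z ∉ D ∧ z ∈ closure D := by
  by_contra! h
  obtain ⟨x, hxU, hxD⟩ := Set.exists_of_ssubset hDU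
  obtain ⟨y, -, hy1, hy2⟩ := hU D (closure D)ᶜ hD isClosed_closure.isOpen_compl
    (fun z hz => by
      by_cases hzD : z ∈ D
      · exact Or.inl hzD
      · exact Or.inr (h z hz hzD))
    (hne.imp fun z hz => ⟨hDU.1 hz, hz⟩) ⟨x, hxU, h x hxU hxD⟩
  exact hy2 (subset_closure hy1)

lemma absorbing_compl (F : Set ℂ) : (absorbing F)ᶜ = UH \ F := by
  ext z
  simp [absorbing, UH, and_comm]

lemma IsBM.height_lt_of_ssubset {Ω : Type*} [MeasurableSpace Ω] {P : Measure Ω}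
    {X : Ω → ℝ≥0 → ℂ} {p : ℂ} {F F' : Set ℂ} {M : ℝ} {Λ : Measure (ℝ≥0 → ℂ)}
    [IsProbabilityMeasure Λ] (hX : ∀ x, ∃ P : Measure Ω, ∃ X : Ω → ℝ≥0 → ℂ, IsBM P X x)
    (h : IsBM P X p) (hΛ : IsBMLaw Λ) (hF : IsHHull F) (hF' : IsHHull F') (hFF' : F ⊂ F')
    (hM : 0 ≤ M) (hFM : ∀ z ∈ F', z.im ≤ M) (hp : M < p.im) :
    height Λ (absorbing F) M p < height Λ (absorbing F') M p := by
  have hA := isClosed_absorbing hF.2.1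
  have hA' := isClosed_absorbing hF'.2.1
  have hsc : IsSimplyConnected (absorbing F')ᶜ := by
    rw [absorbing_compl]
    exact hF'.2.2
  have hUc : IsPreconnected (absorbing F)ᶜ := by
    rw [absorbing_compl]
    have := hF.2.2
    exact isPreconnected_iff_preconnectedSpace.2 inferInstance
  have hpD : p ∈ (absorbing F')ᶜ := fun hpA =>
    hp.not_ge (im_le_of_mem_absorbing hM hFM p hpA)
  have hss : (absorbing F')ᶜ ⊂ (absorbing F)ᶜ := by
    rw [absorbing_compl, absorbing_compl]
    obtain ⟨x, hx', hx⟩ := Set.exists_of_ssubset hFF'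
    exact ⟨Set.sdiff_subset_sdiff_right hFF'.1, fun hs => (hs ⟨hF'.1 hx', hx⟩).2 hx'⟩
  obtain ⟨z₀, hz₀U, hz₀D, hz₀c⟩ := exists_mem_closure_of_ssubset hA'.isOpen_compl hUc hss ⟨p, hpD⟩
  obtain ⟨γ, hγc, hγ0, hγ1, ε, hε, hεp, hg⟩ := exists_loop hA'.isOpen_compl hsc hA.isOpen_compl
    hss.1 hz₀D hz₀U hz₀c hpD (sub_pos.2 hp)
  obtain ⟨P', X', h'⟩ := hX 0
  obtain ⟨t, ht⟩ := h'.exists_follow h hγc hγ0 hε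
  refine h.height_lt hΛ hA hA' (Set.union_subset_union_left _ hFF'.1) Set.subset_union_right hM
    (im_le_of_mem_absorbing hM hFM) (hM.trans hp.le) hX (t := t)
    fun h0 => ht (measure_mono_null (fun ω hω => ?_) h0)
  have hω' : ∀ s : ℝ≥0, s ≤ 1 → dist (X ω (s * t)) (γ s) < ε := hω
  obtain ⟨hgU, s, hs, hsD⟩ := hg (fun s => X ω (s.toNNReal * t))
    ((h.cont ω).comp (continuous_real_toNNReal.mul continuous_const)).continuousOn
    (by simp [h.start]) (fun s hs => by
      have := hω' s.toNNReal (by simpa using hs.2)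
      rwa [Real.coe_toNNReal _ hs.1] at this)
  refine ⟨⟨⟨s.toNNReal * t, ?_, not_not.1 hsD⟩, ?_⟩, ?_⟩
  · exact mul_le_of_le_one_left zero_le (by simpa using hs.2)
  · rintro ⟨u, hu, huA⟩
    have hu1 : u / t ≤ 1 := div_le_one_of_le₀ hu zero_le
    refine hgU (u / t : ℝ≥0) ⟨NNReal.coe_nonneg _, by exact_mod_cast hu1⟩ ?_
    rw [Real.toNNReal_coe]
    rcases eq_or_ne t 0 with ht0 | ht0
    · have hu0 : u = 0 := le_antisymm (ht0 ▸ hu) zero_le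
      simpa [ht0, hu0] using huA
    · rwa [div_mul_cancel₀ _ ht0]
  · have h1 := hω' 1 le_rfl
    rw [one_mul, NNReal.coe_one, hγ1] at h1
    have h2 := Complex.abs_im_le_norm (X ω t - p)
    rw [← dist_eq_norm, Complex.sub_im] at h2
    have h3 := (abs_le.1 h2).1
    change M < (X ω t).im
    linarith

end HalfPlaneCapacity


open HalfPlaneCapacity in
/-- Monotonicity of half-plane capacity: if `F ⊆ Ftil` are ℍ-hulls with
`Im Ftil < ∞` and `hcap Ftil = c < ∞`, then `hcap F` exists, `hcap F ≤ c`, and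
the inequality is strict when `F ⊊ Ftil`. -/
theorem hcap_monotone {Ω : Type*} [MeasurableSpace Ω] (BM : PlanarBM Ω)
    (F Ftil : Set ℂ)
    (hF : IsHHull F) (hFtil : IsHHull Ftil) (hsub : F ⊆ Ftil)
    (hIm : BddAbove (Complex.im '' Ftil))
    (c : ℝ) (hc : HasHcap BM Ftil c) :
    ∃ a : ℝ, HasHcap BM F a ∧ a ≤ c ∧ (F ⊂ Ftil → a < c) := by
  obtain ⟨M₀, hM₀⟩ := hIm
  have hM : 0 ≤ max M₀ 0 := le_max_right _ _
  have hFM : ∀ z ∈ Ftil, z.im ≤ max M₀ 0 := fun z hz => (hM₀ ⟨z, hz, rfl⟩).trans (le_max_left _ _)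
  have hX : ∀ x, ∃ P : Measure Ω, ∃ X : Ω → NNReal → ℂ, IsBM P X x := fun x => by
    obtain ⟨X, hX, -⟩ := exists_isBM BM x
    exact ⟨_, X, hX⟩
  obtain ⟨P₀, X₀, h₀⟩ := hX 0
  obtain ⟨Λ, hΛp, hΛ⟩ := h₀.exists_law
  obtain ⟨a, ha, hgap⟩ := exists_hasHcap BM hΛ hF.1 hF.2.1 hFtil.1 hFtil.2.1 hsub hM hFM hc
  set y : ℝ := max M₀ 0 + 1
  have hy : max M₀ 0 < y := lt_add_one _
  have hyim : ((y : ℂ) * Complex.I).im = y := by simp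
  obtain ⟨P, X, h⟩ := hX ((y : ℂ) * Complex.I)
  refine ⟨a, ha, ?_, fun hss => ?_⟩
  · have h1 := h.height_mono hΛ (isClosed_absorbing hF.2.1) (isClosed_absorbing hFtil.2.1)
      (Set.union_subset_union_left _ hsub) Set.subset_union_right hM
      (im_le_of_mem_absorbing hM hFM) (by rw [hyim]; exact hM.trans hy.le)
    have h2 := hgap y hy
    have h3 := mul_nonneg (sub_nonneg.2 hy.le) (sub_nonneg.2 h1)
    linarith
  · have h1 := h.height_lt_of_ssubset hX hΛ hF hFtil hss hM hFM (by rwa [hyim])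
    have h2 := hgap y hy
    have h3 := mul_pos (sub_pos.2 hy) (sub_pos.2 h1)
    linarith
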